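/- arXiv:1206.6173 — 3 statements merged into one kernel-verified Lean document; each statement's English description precedes it below -/
import Mathlib

section
/- Let g = ⊕_{p∈ℤ} g_p be a pseudo-product graded Lie algebra over ℂ with pseudo-product structure (e, f). If the negative part g_- = ⊕_{p<0} g_p is non-degenerate (i.e., for X ∈ g_{-1}, [X, g_{-1}] = 0 implies X = 0), then g is finite-dimensional. -/
open scoped TensorProduct

/-- A ℤ-graded Lie algebra (GLA) structure over `ℂ` on a Lie algebra `L`:
a family of finite-dimensional subspaces forming an internal direct sum and
compatible with the bracket. -/
structure GLA (L : Type) [LieRing L] [LieAlgebra ℂ L] : Type where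
  g : ℤ → Submodule ℂ L
  internal : DirectSum.IsInternal g
  bracket_mem : ∀ p q : ℤ, ∀ x ∈ g p, ∀ y ∈ g q, ⁅x, y⁆ ∈ g (p + q)
  findim : ∀ p : ℤ, FiniteDimensional ℂ (g p)

namespace GLA

variable {L : Type} [LieRing L] [LieAlgebra ℂ L]

/-- A GLA is a fundamental graded Lie algebra (FGLA): it is finite-dimensional,
concentrated in negative degrees, `g₋₁ ≠ 0`, and it is generated by `g₋₁`
(i.e. `g_{p-1} = [g_p, g₋₁]` for all `p < 0`). -/
structure IsFGLA (G : GLA L) : Prop where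
  fd : FiniteDimensional ℂ L
  nonneg : ∀ p : ℤ, 0 ≤ p → G.g p = ⊥
  neg_one_ne_bot : G.g (-1) ≠ ⊥
  generated : ∀ p : ℤ, p < 0 →
    G.g (p - 1) = Submodule.span ℂ {z : L | ∃ x ∈ G.g p, ∃ y ∈ G.g (-1), z = ⁅x, y⁆}

/-- A GLA is of the `μ`-th kind (equivalently, of depth `μ`). -/
def IsOfKind (G : GLA L) (μ : ℕ) : Prop :=
  G.g (-(μ : ℤ)) ≠ ⊥ ∧ ∀ p : ℤ, p < -(μ : ℤ) → G.g p = ⊥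

/-- Transitivity of a GLA. -/
def Transitive (G : GLA L) : Prop :=
  ∀ p : ℤ, 0 ≤ p → ∀ x ∈ G.g p,
    (∀ q : ℤ, q < 0 → ∀ y ∈ G.g q, ⁅x, y⁆ = 0) → x = 0

end GLA

/-- `G` is a free fundamental graded Lie algebra of type `(n, μ)`:
it is an FGLA of the `μ`-th kind with `dim g₋₁ = n`, and every surjective linear map
from `g₋₁` onto the degree `-1` part of an FGLA of the `μ`-th kind extends uniquely
to a graded Lie algebra epimorphism. -/
def IsFreeFGLA {L : Type} [LieRing L] [LieAlgebra ℂ L] (G : GLA L) (n μ : ℕ) : Prop :=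
  G.IsFGLA ∧ G.IsOfKind μ ∧ Module.finrank ℂ (G.g (-1)) = n ∧
  ∀ (L' : Type) [LieRing L'] [LieAlgebra ℂ L'] (G' : GLA L'),
    G'.IsFGLA → G'.IsOfKind μ →
    ∀ φ : (G.g (-1)) →ₗ[ℂ] (G'.g (-1)), Function.Surjective φ →
      ∃! Φ : L →ₗ⁅ℂ⁆ L',
        (∀ p : ℤ, ∀ x ∈ G.g p, Φ x ∈ G'.g p) ∧ Function.Surjective Φ ∧
        ∀ x : G.g (-1), Φ (x : L) = (φ x : L')

/-- A pseudo-product FGLA: an FGLA together with nonzero subspaces `e`, `f` with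
`g₋₁ = e ⊕ f` and `[e,e] = [f,f] = 0`. -/
structure IsPPFGLA {L : Type} [LieRing L] [LieAlgebra ℂ L]
    (G : GLA L) (e f : Submodule ℂ L) : Prop where
  fgla : G.IsFGLA
  e_ne_bot : e ≠ ⊥
  f_ne_bot : f ≠ ⊥
  sup_eq : e ⊔ f = G.g (-1)
  inf_eq : e ⊓ f = ⊥
  lie_ee : ∀ x ∈ e, ∀ y ∈ e, ⁅x, y⁆ = (0 : L)
  lie_ff : ∀ x ∈ f, ∀ y ∈ f, ⁅x, y⁆ = (0 : L)

/-- `(G; e, f)` is a free pseudo-product FGLA of type `(m, n, μ)`. -/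
def IsFreePPFGLA {L : Type} [LieRing L] [LieAlgebra ℂ L] (G : GLA L)
    (e f : Submodule ℂ L) (m n μ : ℕ) : Prop :=
  IsPPFGLA G e f ∧ G.IsOfKind μ ∧
  Module.finrank ℂ e = m ∧ Module.finrank ℂ f = n ∧
  ∀ (L' : Type) [LieRing L'] [LieAlgebra ℂ L'] (G' : GLA L') (e' f' : Submodule ℂ L'),
    IsPPFGLA G' e' f' → G'.IsOfKind μ →
    ∀ φ : (G.g (-1)) →ₗ[ℂ] (G'.g (-1)), Function.Surjective φ →
      (∀ x : L, ∀ hx : x ∈ G.g (-1), x ∈ e → (φ ⟨x, hx⟩ : L') ∈ e') →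
      (∀ x : L, ∀ hx : x ∈ G.g (-1), x ∈ f → (φ ⟨x, hx⟩ : L') ∈ f') →
      ∃! Φ : L →ₗ⁅ℂ⁆ L',
        (∀ p : ℤ, ∀ x ∈ G.g p, Φ x ∈ G'.g p) ∧ Function.Surjective Φ ∧
        ∀ x : G.g (-1), Φ (x : L) = (φ x : L')

/-- `G` (on `LG`, with embedding `ι` of `Lm`) is the prolongation of the FGLA `M`:
`ι` embeds `M` as the negative part of `G`, `G` is transitive, and `G` is maximal among
transitive GLAs with negative part `M`. -/
structure IsProlongation {Lm LG : Type} [LieRing Lm] [LieAlgebra ℂ Lm]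
    [LieRing LG] [LieAlgebra ℂ LG] (M : GLA Lm) (G : GLA LG)
    (ι : Lm →ₗ⁅ℂ⁆ LG) : Prop where
  inj : Function.Injective ι
  graded_neg : ∀ p : ℤ, p < 0 → (M.g p).map ι.toLinearMap = G.g p
  trans : G.Transitive
  max : ∀ (LH : Type) [LieRing LH] [LieAlgebra ℂ LH] (H : GLA LH) (j : Lm →ₗ⁅ℂ⁆ LH),
    Function.Injective j → (∀ p : ℤ, p < 0 → (M.g p).map j.toLinearMap = H.g p) →
    H.Transitive →
    ∃ ψ : LH →ₗ⁅ℂ⁆ LG, Function.Injective ψ ∧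
      (∀ p : ℤ, (H.g p).map ψ.toLinearMap ≤ G.g p) ∧ ψ.comp j = ι

/-- `G` (with embedding `ι`) is the prolongation of the pseudo-product FGLA `(M; e, f)`:
the negative part is `M`, `G` is transitive, the degree-0 part preserves `e` and `f`,
and `G` is maximal among such transitive GLAs. -/
structure IsPPProlongation {Lm LG : Type} [LieRing Lm] [LieAlgebra ℂ Lm]
    [LieRing LG] [LieAlgebra ℂ LG] (M : GLA Lm) (e f : Submodule ℂ Lm) (G : GLA LG)
    (ι : Lm →ₗ⁅ℂ⁆ LG) : Prop where
  inj : Function.Injective ι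
  graded_neg : ∀ p : ℤ, p < 0 → (M.g p).map ι.toLinearMap = G.g p
  trans : G.Transitive
  e_stable : ∀ x ∈ G.g 0, ∀ y ∈ e, ⁅x, ι y⁆ ∈ e.map ι.toLinearMap
  f_stable : ∀ x ∈ G.g 0, ∀ y ∈ f, ⁅x, ι y⁆ ∈ f.map ι.toLinearMap
  max : ∀ (LH : Type) [LieRing LH] [LieAlgebra ℂ LH] (H : GLA LH) (j : Lm →ₗ⁅ℂ⁆ LH),
    Function.Injective j → (∀ p : ℤ, p < 0 → (M.g p).map j.toLinearMap = H.g p) →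
    H.Transitive →
    (∀ x ∈ H.g 0, ∀ y ∈ e, ⁅x, j y⁆ ∈ e.map j.toLinearMap) →
    (∀ x ∈ H.g 0, ∀ y ∈ f, ⁅x, j y⁆ ∈ f.map j.toLinearMap) →
    ∃ ψ : LH →ₗ⁅ℂ⁆ LG, Function.Injective ψ ∧
      (∀ p : ℤ, (H.g p).map ψ.toLinearMap ≤ G.g p) ∧ ψ.comp j = ι

/-- `G` is a finite-dimensional simple graded Lie algebra of type `(A, Pi1)`, where `A`
is the Cartan matrix (with convention `⁅hᵢ, eⱼ⁆ = Aᵢⱼ • eⱼ`) and `Pi1` is the set of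
simple roots of degree one: there is a set of Chevalley generators compatible with the
grading, the generators `eᵢ` (resp. `fᵢ`) having degree `1` (resp. `-1`) for `i ∈ Pi1`
and degree `0` otherwise. -/
def IsSimpleGLAOfType {LG : Type} [LieRing LG] [LieAlgebra ℂ LG] (G : GLA LG)
    {l : ℕ} (A : Matrix (Fin l) (Fin l) ℤ) (Pi1 : Finset (Fin l)) : Prop :=
  FiniteDimensional ℂ LG ∧ LieAlgebra.IsSimple ℂ LG ∧
  ∃ h e f : Fin l → LG,
    LinearIndependent ℂ h ∧ (∀ i, e i ≠ 0) ∧ (∀ i, f i ≠ 0) ∧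
    (∀ i j, ⁅h i, h j⁆ = 0) ∧
    (∀ i, ⁅e i, f i⁆ = h i) ∧ (∀ i j, i ≠ j → ⁅e i, f j⁆ = 0) ∧
    (∀ i j, ⁅h i, e j⁆ = A i j • e j) ∧
    (∀ i j, ⁅h i, f j⁆ = (-(A i j)) • f j) ∧
    LieSubalgebra.lieSpan ℂ LG (Set.range e ∪ Set.range f) = ⊤ ∧
    (∀ i, h i ∈ G.g 0) ∧
    (∀ i, e i ∈ G.g (if i ∈ Pi1 then 1 else 0)) ∧
    (∀ i, f i ∈ G.g (-(if i ∈ Pi1 then 1 else 0)))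

/-- The Cartan matrix of type `A_l` (Bourbaki numbering, 0-indexed). -/
def cartanA (l : ℕ) : Matrix (Fin l) (Fin l) ℤ :=
  Matrix.of fun i j =>
    if i = j then 2
    else if (i : ℕ) + 1 = (j : ℕ) ∨ (j : ℕ) + 1 = (i : ℕ) then -1 else 0

/-- The Cartan matrix of type `B_l` (Bourbaki numbering, 0-indexed; the last simple
root is the short one), with convention `⁅hᵢ, eⱼ⁆ = Aᵢⱼ • eⱼ`, i.e. `Aᵢⱼ = αⱼ(hᵢ)`. -/
def cartanB (l : ℕ) : Matrix (Fin l) (Fin l) ℤ :=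
  Matrix.of fun i j =>
    if i = j then 2
    else if (i : ℕ) = l - 1 ∧ (j : ℕ) + 1 = (i : ℕ) then -2
    else if (i : ℕ) + 1 = (j : ℕ) ∨ (j : ℕ) + 1 = (i : ℕ) then -1 else 0

/-- The Cartan matrix of type `G₂` (Bourbaki numbering, 0-indexed; `α₁` is the short
root), with convention `⁅hᵢ, eⱼ⁆ = Aᵢⱼ • eⱼ`, i.e. `Aᵢⱼ = αⱼ(hᵢ)`. -/
def cartanG2 : Matrix (Fin 2) (Fin 2) ℤ := !![2, -3; -1, 2]

/-- A pseudo-product graded Lie algebra: a transitive GLA whose negative part is an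
FGLA equipped with a pseudo-product structure `(e, f)` preserved by `g₀`. -/
structure IsPseudoProductGLA {L : Type} [LieRing L] [LieAlgebra ℂ L]
    (G : GLA L) (e f : Submodule ℂ L) : Prop where
  trans : G.Transitive
  e_ne_bot : e ≠ ⊥
  f_ne_bot : f ≠ ⊥
  sup_eq : e ⊔ f = G.g (-1)
  inf_eq : e ⊓ f = ⊥
  lie_ee : ∀ x ∈ e, ∀ y ∈ e, ⁅x, y⁆ = (0 : L)
  lie_ff : ∀ x ∈ f, ∀ y ∈ f, ⁅x, y⁆ = (0 : L)
  neg_one_ne_bot : G.g (-1) ≠ ⊥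
  generated : ∀ p : ℤ, p < 0 →
    G.g (p - 1) = Submodule.span ℂ {z : L | ∃ x ∈ G.g p, ∃ y ∈ G.g (-1), z = ⁅x, y⁆}
  depth_bdd : ∃ μ : ℕ, ∀ p : ℤ, p < -(μ : ℤ) → G.g p = ⊥
  e_stable : ∀ x ∈ G.g 0, ∀ y ∈ e, ⁅x, y⁆ ∈ e
  f_stable : ∀ x ∈ G.g 0, ∀ y ∈ f, ⁅x, y⁆ ∈ f

/-- The symmetric square `S²(V)` of a vector space, realized as the subspace of
symmetric tensors in `V ⊗ V`. -/
noncomputable def symSq (V : Type) [AddCommGroup V] [Module ℂ V] : Submodule ℂ (TensorProduct ℂ V V) :=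
  LinearMap.eqLocus (TensorProduct.comm ℂ V V).toLinearMap LinearMap.id

lemma tmul_self_mem_symSq {V : Type} [AddCommGroup V] [Module ℂ V] (x : V) :
    x ⊗ₜ[ℂ] x ∈ symSq V := by
  show (TensorProduct.comm ℂ V V).toLinearMap (x ⊗ₜ[ℂ] x) = LinearMap.id (x ⊗ₜ[ℂ] x)
  simp

open Polynomial in
theorem aeval_mul_sub_mul_aeval {R A : Type*} [CommRing R] [Ring A] [Algebra R A] {a b : A} {r : R}
    (h : a * b - b * a = algebraMap R A r) (p : R[X]) :
    aeval a p * b - b * aeval a p = r • aeval a (derivative p) := by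
  have key : ∀ n : ℕ, a ^ n * b - b * a ^ n = (n : R) • r • a ^ (n - 1) := by
    intro n
    induction n with
    | zero => simp
    | succ n ih =>
      have : a ^ (n + 1) * b - b * a ^ (n + 1) =
          a ^ n * (a * b - b * a) + (a ^ n * b - b * a ^ n) * a := by noncomm_ring
      rw [this, h, ih]
      rcases n with _ | n
      · simp [Algebra.smul_def]
      · simp only [Nat.add_sub_cancel, smul_mul_assoc, ← pow_succ, ← Algebra.commutes,
          ← Algebra.smul_def]
        push_cast
        module
  induction p using Polynomial.induction_on' with
  | add p q hp hq =>
    simp only [map_add, smul_add, ← hp, ← hq]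
    noncomm_ring
  | monomial n c =>
    rw [derivative_monomial, aeval_monomial, aeval_monomial, ← Algebra.smul_def,
      ← Algebra.smul_def, smul_mul_assoc, mul_smul_comm, ← smul_sub, key]
    module

open Polynomial in
/-- If a scalar is a commutator of two endomorphisms of a finitely generated module, then it acts
nilpotently, up to a factorial. -/
theorem factorial_smul_pow_smul_eq_zero {R M : Type*} [CommRing R] [AddCommGroup M] [Module R M]
    [Module.Finite R M] {a b : Module.End R M} {r : R}
    (h : ∀ m, a (b m) - b (a m) = r • m) (m : M) :
    (⊤ : Submodule R M).spanFinrank.factorial • r ^ (⊤ : Submodule R M).spanFinrank • m = 0 := by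
  have h : a * b - b * a = algebraMap R _ r := LinearMap.ext h
  obtain ⟨p, hp, hn, h0⟩ := LinearMap.exists_monic_and_natDegree_eq_and_aeval_eq_zero R a
  rw [← hn]
  have key : ∀ k : ℕ, r ^ k • aeval a (derivative^[k] p) = 0 := by
    intro k
    induction k with
    | zero => simpa using h0
    | succ k ih =>
      rw [Function.iterate_succ_apply', pow_succ, mul_smul, ← aeval_mul_sub_mul_aeval h, smul_sub,
        ← smul_mul_assoc, ← mul_smul_comm, ih]
      simp
  have hd : derivative^[p.natDegree] p = C (p.natDegree.factorial : R) := by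
    rw [eq_C_of_natDegree_eq_zero
      (Nat.le_zero.1 ((natDegree_iterate_derivative p p.natDegree).trans (by simp))),
      coeff_iterate_derivative]
    simp [hp.coeff_natDegree, Nat.descFactorial_self]
  have := LinearMap.congr_fun (key p.natDegree) m
  rw [hd, aeval_C] at this
  rw [smul_comm, ← Nat.cast_smul_eq_nsmul R]
  simpa [Nat.cast_smul_eq_nsmul] using this

open scoped IsMulCommutative in
/-- Let `S` be a commuting set of endomorphisms of `D`, such that `D` is generated by `n` elements
under the action of `S`. A member of `S` that is a commutator of two endomorphisms commuting with
`S` has vanishing `n`-th power. -/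
theorem commutator_pow_eq_zero_of_generators {K D : Type*} [Field K] [CharZero K] [AddCommGroup D]
    [Module K D] {S : Set (Module.End K D)} (hS : ∀ s ∈ S, ∀ t ∈ S, s * t = t * s)
    {n : ℕ} (φ : Fin n → D)
    (hφ : ∀ N : Submodule K D, (∀ i, φ i ∈ N) → (∀ s ∈ S, ∀ d ∈ N, s d ∈ N) → N = ⊤)
    {a b : Module.End K D} (ha : ∀ s ∈ S, a * s = s * a) (hb : ∀ s ∈ S, b * s = s * b)
    (hab : a * b - b * a ∈ S) : (a * b - b * a) ^ n = 0 := by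
  let R := Algebra.adjoin K S
  have : IsMulCommutative R := Algebra.isMulCommutative_adjoin K hS
  have hcomm : ∀ c : Module.End K D, (∀ s ∈ S, c * s = s * c) → ∀ r : R, ∀ d : D,
      c (r • d) = r • c d := by
    intro c hc r d
    have : Commute c (r : Module.End K D) :=
      Algebra.commute_of_mem_adjoin_of_forall_mem_commute r.2 fun s hs => hc s hs
    exact LinearMap.congr_fun this.eq d
  let a' : Module.End R D := { toFun := a, map_add' := a.map_add, map_smul' := hcomm a ha }
  let b' : Module.End R D := { toFun := b, map_add' := b.map_add, map_smul' := hcomm b hb }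
  let v : R := ⟨a * b - b * a, Algebra.subset_adjoin hab⟩
  have h : ∀ d, a' (b' d) - b' (a' d) = v • d := fun d => rfl
  have hspan : Submodule.span R (Set.range φ) = ⊤ := by
    have := hφ ((Submodule.span R (Set.range φ)).restrictScalars K)
      (fun i => Submodule.subset_span ⟨i, rfl⟩)
      (fun s hs d hd => Submodule.smul_mem _ (⟨s, Algebra.subset_adjoin hs⟩ : R) hd)
    simpa using this
  have : Module.Finite R D := ⟨hspan ▸ Submodule.fg_span (Set.finite_range φ)⟩
  have hle : (⊤ : Submodule R D).spanFinrank ≤ n := by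
    rw [← hspan]
    refine (Submodule.spanFinrank_span_le_ncard_of_finite (Set.finite_range φ)).trans ?_
    simpa [Set.image_univ, Set.ncard_univ] using
      Set.ncard_image_le (f := φ) (s := Set.univ) Set.finite_univ
  refine pow_eq_zero_of_le hle ?_
  ext d
  have hd := factorial_smul_pow_smul_eq_zero (R := R) (a := a') (b := b') (r := v) h d
  set k := (⊤ : Submodule R D).spanFinrank
  have hd' : (k.factorial : K) • ((a * b - b * a) ^ k) d = 0 := by
    rw [Nat.cast_smul_eq_nsmul]
    exact hd
  exact (smul_eq_zero.1 hd').resolve_left (by exact_mod_cast k.factorial_ne_zero)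

/-- Dual form of `commutator_pow_eq_zero_of_generators`: instead of generators, there are `n`
linear forms that do not vanish simultaneously on any nonzero `S`-stable subspace. -/
theorem commutator_pow_eq_zero_of_cogenerators {K B : Type*} [Field K] [CharZero K]
    [AddCommGroup B] [Module K B] [FiniteDimensional K B] {S : Set (Module.End K B)}
    (hS : ∀ s ∈ S, ∀ t ∈ S, s * t = t * s) {n : ℕ} (φ : Fin n → Module.Dual K B)
    (hφ : ∀ N : Submodule K B, (∀ i, ∀ x ∈ N, φ i x = 0) → (∀ s ∈ S, ∀ x ∈ N, s x ∈ N) → N = ⊥)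
    {a b : Module.End K B} (ha : ∀ s ∈ S, a * s = s * a) (hb : ∀ s ∈ S, b * s = s * b)
    (hab : b * a - a * b ∈ S) : (b * a - a * b) ^ n = 0 := by
  have hmul : ∀ s t : Module.End K B, s.dualMap * t.dualMap = (t * s).dualMap := fun s t => rfl
  have hsub : a.dualMap * b.dualMap - b.dualMap * a.dualMap = (b * a - a * b).dualMap := by
    ext; simp
  have key := commutator_pow_eq_zero_of_generators (S := (fun s => s.dualMap) '' S)
    (a := a.dualMap) (b := b.dualMap) (n := n) (φ := φ) ?_ ?_ ?_ ?_ ?_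
  · rw [hsub] at key
    have hpow : ∀ k : ℕ, (b * a - a * b).dualMap ^ k = ((b * a - a * b) ^ k).dualMap := by
      intro k
      induction k with
      | zero => rfl
      | succ k ih => rw [pow_succ, ih, hmul, pow_succ']
    rw [hpow] at key
    ext x
    refine (Module.forall_dual_apply_eq_zero_iff K _).1 fun ψ => ?_
    exact LinearMap.congr_fun (LinearMap.congr_fun key ψ) x
  · rintro _ ⟨s, hs, rfl⟩ _ ⟨t, ht, rfl⟩
    simp only [hmul, hS s hs t ht]
  · intro N hN hSN
    rw [← Subspace.dualCoannihilator_dualAnnihilator_eq (W := N),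
      hφ N.dualCoannihilator, Submodule.dualAnnihilator_bot]
    · intro i x hx
      exact (Submodule.mem_dualCoannihilator _).1 hx _ (hN i)
    · intro s hs x hx
      rw [Submodule.mem_dualCoannihilator] at hx ⊢
      exact fun ψ hψ => hx _ (hSN _ ⟨s, hs, rfl⟩ ψ hψ)
  · rintro _ ⟨s, hs, rfl⟩
    simp only [hmul, ha s hs]
  · rintro _ ⟨s, hs, rfl⟩
    simp only [hmul, hb s hs]
  · exact ⟨_, hab, hsub.symm⟩

namespace GLA

variable {L : Type} [LieRing L] [LieAlgebra ℂ L]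

/-- The sum of the components of degree less than `T`. -/
def fil (G : GLA L) (T : ℤ) : Submodule ℂ L := ⨆ p : Set.Iio T, G.g p

/-- The common centralizer of the components of degree at most `-q`. -/
def lowCentralizer (G : GLA L) (q : ℤ) : Submodule ℂ L where
  carrier := {x | ∀ r : ℤ, r ≤ -q → ∀ y ∈ G.g r, ⁅y, x⁆ = 0}
  add_mem' hx hy r hr z hz := by rw [lie_add, hx r hr z hz, hy r hr z hz, add_zero]
  zero_mem' r _ y _ := lie_zero y
  smul_mem' c x hx r hr y hy := by rw [lie_smul, hx r hr y hy, smul_zero]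

variable (G : GLA L)

lemma g_le_fil {p T : ℤ} (h : p < T) : G.g p ≤ G.fil T :=
  le_iSup (fun p : Set.Iio T => G.g p) ⟨p, h⟩

lemma finiteDimensional_fil {μ : ℤ} (hμ : ∀ p < μ, G.g p = ⊥) (T : ℤ) :
    FiniteDimensional ℂ (G.fil T) := by
  have := G.findim
  refine Submodule.finiteDimensional_of_le (S₂ := ⨆ p : Set.Ico μ T, G.g p) (iSup_le ?_)
  rintro ⟨p, hp⟩
  rcases lt_or_ge p μ with h | h
  · rw [hμ p h]
    exact bot_le
  · exact le_iSup (fun p : Set.Ico μ T => G.g p) ⟨p, h, hp⟩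

lemma fil_eq_bot {μ T : ℤ} (hμ : ∀ p < μ, G.g p = ⊥) (hT : T ≤ μ) : G.fil T = ⊥ :=
  iSup_eq_bot.2 fun p => hμ p (lt_of_lt_of_le p.2 hT)

lemma lie_mem_fil {s T : ℤ} {y x : L} (hy : y ∈ G.g s) (hx : x ∈ G.fil T) :
    ⁅y, x⁆ ∈ G.fil (s + T) := by
  suffices G.fil T ≤ (G.fil (s + T)).comap (LieAlgebra.ad ℂ L y) from this hx
  refine iSup_le fun p z hz => ?_
  exact G.g_le_fil (add_lt_add_right p.2 s) (G.bracket_mem s p y hy z hz)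

lemma lie_mem_lowCentralizer {q s : ℤ} (hs : s ≤ 0) {y x : L} (hy : y ∈ G.g s)
    (hx : x ∈ G.lowCentralizer q) : ⁅y, x⁆ ∈ G.lowCentralizer q := by
  intro r hr z hz
  rw [leibniz_lie, hx r hr z hz, lie_zero, add_zero]
  exact hx (r + s) (by omega) _ (G.bracket_mem r s z hz y hy)

lemma lie_lie_comm_of_mem_lowCentralizer {q s t : ℤ} (h : s + t ≤ -q) {y z x : L}
    (hy : y ∈ G.g s) (hz : z ∈ G.g t) (hx : x ∈ G.lowCentralizer q) :
    ⁅y, ⁅z, x⁆⁆ = ⁅z, ⁅y, x⁆⁆ := by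
  rw [leibniz_lie, hx _ h _ (G.bracket_mem s t y hy z hz), zero_add]

open DirectSum in
/-- If the homogeneous elements centralizing a family `D` of homogeneous elements vanish in degrees
at least `N`, then every element centralizing `D` has all its components in degrees below `N`. -/
lemma mem_fil_of_forall_lie_eq_zero {N : ℤ} (D : ℤ → Set L) (hD : ∀ r, ∀ y ∈ D r, y ∈ G.g r)
    (hN : ∀ p ≥ N, ∀ x ∈ G.g p, (∀ r, ∀ y ∈ D r, ⁅y, x⁆ = 0) → x = 0)
    {x : L} (hx : ∀ r, ∀ y ∈ D r, ⁅y, x⁆ = 0) : x ∈ G.fil N := by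
  classical
  let _ := G.internal.chooseDecomposition
  have hlie : ∀ r, ∀ y ∈ G.g r, ∀ p, ∀ z : L,
      (decompose G.g ⁅y, z⁆ (r + p) : L) = ⁅y, (decompose G.g z p : L)⁆ := by
    intro r y hy p z
    induction z using Decomposition.inductionOn G.g with
    | zero => simp
    | @homogeneous i m =>
      have hm := G.bracket_mem r i y hy m m.2
      by_cases hip : i = p
      · subst hip
        rw [decompose_of_mem_same _ hm, decompose_of_mem_same _ m.2]
      · rw [decompose_of_mem_ne _ hm (by omega), decompose_of_mem_ne _ m.2 hip, lie_zero]
    | add z w hz hw =>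
      simp only [lie_add, decompose_add, DirectSum.add_apply, Submodule.coe_add, hz, hw]
  rw [← sum_support_decompose G.g x]
  refine Submodule.sum_mem _ fun p hp => ?_
  rcases lt_or_ge p N with h | h
  · exact G.g_le_fil h (decompose G.g x p).2
  · rw [hN p h _ (decompose G.g x p).2]
    · exact Submodule.zero_mem _
    · intro r y hy
      rw [← hlie r y (hD r y hy), hx r y hy, decompose_zero]
      rfl

/-- Brackets of elements of degrees `1 - q` and `-1` act nilpotently, with a uniform exponent, on
the centralizer of the components of degree less than `-q`. -/
lemma exists_ad_pow_eq_zero {μ q N : ℤ} (hμ : ∀ p < μ, G.g p = ⊥) (hq : 2 ≤ q)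
    (hN : ∀ p ≥ N, ∀ x ∈ G.g p, x ∈ G.lowCentralizer q → x = 0) :
    ∃ n : ℕ, ∀ a ∈ G.g (1 - q), ∀ b ∈ G.g (-1), ∀ T : ℤ,
      ∀ x ∈ G.lowCentralizer (q + 1) ⊓ G.fil T, ((LieAlgebra.ad ℂ L ⁅a, b⁆) ^ n) x = 0 := by
  have := G.finiteDimensional_fil hμ N
  let β := Module.finBasis ℂ (G.fil N)
  choose φ hφ using fun i => LinearMap.exists_extend (β.coord i)
  refine ⟨Module.finrank ℂ (G.fil N), fun a ha b hb T x hx => ?_⟩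
  let B := G.lowCentralizer (q + 1) ⊓ G.fil T
  have : FiniteDimensional ℂ B :=
    have := G.finiteDimensional_fil hμ T
    Submodule.finiteDimensional_of_le (inf_le_right : B ≤ G.fil T)
  have hB : ∀ s < 0, ∀ y ∈ G.g s, ∀ x ∈ B, (LieAlgebra.ad ℂ L y) x ∈ B := by
    intro s hs y hy x hx
    refine ⟨G.lie_mem_lowCentralizer hs.le hy hx.1, ?_⟩
    have hle : G.fil (s + T) ≤ G.fil T :=
      iSup_le fun p => G.g_le_fil (lt_trans p.2 (by simpa using hs))
    exact hle (G.lie_mem_fil hy hx.2)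
  let ρ : ∀ s < 0, G.g s → Module.End ℂ B := fun s hs y =>
    (LieAlgebra.ad ℂ L (y : L)).restrict (hB s hs y y.2)
  have hq0 : -q < 0 := by omega
  have hcomm : ∀ s hs y z, ρ s hs y * ρ (-q) hq0 z = ρ (-q) hq0 z * ρ s hs y := by
    intro s hs y z
    ext x
    exact G.lie_lie_comm_of_mem_lowCentralizer (by omega) y.2 z.2 x.2.1
  have hab : ⁅a, b⁆ ∈ G.g (-q) := by
    have := G.bracket_mem _ _ a ha b hb
    rwa [show 1 - q + -1 = -q by ring] at this
  have hsub : ρ (1 - q) (by omega) ⟨a, ha⟩ * ρ (-1) (by omega) ⟨b, hb⟩ -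
      ρ (-1) (by omega) ⟨b, hb⟩ * ρ (1 - q) (by omega) ⟨a, ha⟩ = ρ (-q) hq0 ⟨⁅a, b⁆, hab⟩ := by
    ext x
    exact (lie_lie a b (x : L)).symm
  have key := commutator_pow_eq_zero_of_cogenerators (S := Set.range (ρ (-q) hq0))
    (a := ρ (-1) (by omega) ⟨b, hb⟩) (b := ρ (1 - q) (by omega) ⟨a, ha⟩)
    (φ := fun i => (φ i).domRestrict B) ?_ ?_ ?_ ?_ ?_
  · rw [hsub] at key
    have hpow : ∀ (k : ℕ) (x : B), ((ρ (-q) hq0 ⟨⁅a, b⁆, hab⟩ ^ k) x : L) =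
        ((LieAlgebra.ad ℂ L ⁅a, b⁆) ^ k) (x : L) := by
      intro k x
      induction k with
      | zero => rfl
      | succ k ih =>
        rw [pow_succ', pow_succ', Module.End.mul_apply, Module.End.mul_apply, ← ih]
        rfl
    rw [← hpow _ ⟨x, hx⟩, key]
    rfl
  · rintro _ ⟨y, rfl⟩ _ ⟨z, rfl⟩
    exact hcomm _ (by omega) _ _
  · intro M hφM hSM
    have hM : ∀ k : ℕ, ∀ x ∈ M, (x : L) ∈ G.fil (μ + k) → x = 0 := by
      intro k
      induction k with
      | zero =>
        intro x _ hxk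
        rw [G.fil_eq_bot hμ (by simp)] at hxk
        exact Subtype.ext hxk
      | succ k ih =>
        intro x hxM hxk
        have hkill : ∀ y ∈ G.g (-q), ⁅y, (x : L)⁆ = 0 := by
          intro y hy
          have h0 := ih _ (hSM _ ⟨⟨y, hy⟩, rfl⟩ x hxM) (by
            have hle : G.fil (-q + (μ + (k + 1 : ℕ))) ≤ G.fil (μ + k) :=
              iSup_le fun p => G.g_le_fil (lt_of_lt_of_le p.2 (by push_cast; omega))
            exact hle (G.lie_mem_fil hy hxk))
          exact congrArg Subtype.val h0
        have hxN : (x : L) ∈ G.fil N := by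
          refine G.mem_fil_of_forall_lie_eq_zero (fun r => {y | y ∈ G.g r ∧ r ≤ -q})
            (fun r y hy => hy.1) (fun p hp x hx h => hN p hp x hx fun r hr y hy => h r y ⟨hy, hr⟩)
            fun r y hy => ?_
          rcases eq_or_lt_of_le hy.2 with h | h
          · exact hkill y (h ▸ hy.1)
          · exact x.2.1 r (by omega) y hy.1
        have hx0 : (⟨x, hxN⟩ : G.fil N) = 0 := by
          refine β.forall_coord_eq_zero_iff.1 fun i => ?_
          rw [← hφ i]
          exact hφM i x hxM
        exact Subtype.ext ((Submodule.mk_eq_zero _ _).1 hx0)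
    refine (Submodule.eq_bot_iff _).2 fun x hx => hM (T - μ).toNat x hx ?_
    have hle : G.fil T ≤ G.fil (μ + (T - μ).toNat) :=
      iSup_le fun p => G.g_le_fil (lt_of_lt_of_le p.2 (by omega))
    exact hle x.2.2
  · rintro _ ⟨z, rfl⟩
    exact hcomm _ (by omega) _ _
  · rintro _ ⟨z, rfl⟩
    exact hcomm _ (by omega) _ _
  · exact ⟨_, hsub.symm⟩

/-- If `G.lowCentralizer q` is bounded above in degree, then so is `G.lowCentralizer (q + 1)`. -/
lemma lowCentralizer_succ_bounded {μ q N : ℤ} (hμ : ∀ p < μ, G.g p = ⊥) (hq : 2 ≤ q)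
    (hgen : G.g (-q) =
      Submodule.span ℂ {z : L | ∃ x ∈ G.g (1 - q), ∃ y ∈ G.g (-1), z = ⁅x, y⁆})
    (hN : ∀ p ≥ N, ∀ x ∈ G.g p, x ∈ G.lowCentralizer q → x = 0) :
    ∃ N' : ℤ, ∀ p ≥ N', ∀ x ∈ G.g p, x ∈ G.lowCentralizer (q + 1) → x = 0 := by
  classical
  obtain ⟨n, hn⟩ := G.exists_ad_pow_eq_zero hμ hq hN
  have hfg : (G.g (-q)).FG := (Submodule.fg_top _).1 (G.findim (-q)).fg_top
  rw [hgen, Submodule.fg_span_iff_fg_span_finset_subset] at hfg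
  obtain ⟨t, ht, hspan⟩ := hfg
  rw [← hgen] at hspan
  have hmem : ∀ v ∈ t, v ∈ G.g (-q) := fun v hv => hspan ▸ Submodule.subset_span hv
  have key : ∀ s ⊆ t, ∃ N' : ℤ, ∀ p ≥ N', ∀ x ∈ G.g p, x ∈ G.lowCentralizer (q + 1) →
      (∀ v ∈ t \ s, ⁅v, x⁆ = 0) → x = 0 := by
    intro s
    induction s using Finset.induction_on with
    | empty =>
      refine fun _ => ⟨N, fun p hp x hx hxq hv => hN p hp x hx fun r hr y hy => ?_⟩
      rcases eq_or_lt_of_le hr with rfl | h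
      · rw [hspan] at hy
        induction hy using Submodule.span_induction with
        | mem y hy => exact hv y (by simpa using hy)
        | zero => exact zero_lie x
        | add y z _ _ hy hz => rw [add_lie, hy, hz, add_zero]
        | smul c y _ hy => rw [smul_lie, hy, smul_zero]
      · exact hxq r (by omega) y hy
    | insert w s hws ih =>
      intro hst
      obtain ⟨N', hN'⟩ := ih fun v hv => hst (Finset.mem_insert_of_mem hv)
      have hwt : w ∈ t := hst (Finset.mem_insert_self w s)
      have hw : w ∈ G.g (-q) := hmem w hwt
      have step : ∀ k : ℕ, ∀ p ≥ N' + k * q, ∀ x ∈ G.g p, x ∈ G.lowCentralizer (q + 1) →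
          (∀ v ∈ t \ insert w s, ⁅v, x⁆ = 0) → ((LieAlgebra.ad ℂ L w) ^ k) x = 0 → x = 0 := by
        intro k
        induction k with
        | zero => exact fun p _ x _ _ _ hx => hx
        | succ k ih =>
          intro p hp x hx hxq hv hk
          have hp' : N' + k * q ≤ -q + p := by
            push_cast at hp
            linarith
          have hp'' : N' ≤ p := by
            push_cast at hp
            nlinarith [mul_nonneg (Int.natCast_nonneg k) (by omega : (0 : ℤ) ≤ q)]
          have hwx : ⁅w, x⁆ = 0 := by
            refine ih _ hp' _ (G.bracket_mem _ _ w hw x hx)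
              (G.lie_mem_lowCentralizer (by omega) hw hxq) (fun v hvt => ?_) hk
            rw [G.lie_lie_comm_of_mem_lowCentralizer (by omega)
              (hmem v (Finset.mem_sdiff.1 hvt).1) hw hxq, hv v hvt, lie_zero]
          refine hN' p hp'' x hx hxq fun v hvt => ?_
          by_cases hvw : v = w
          · rw [hvw, hwx]
          · refine hv v ?_
            simp only [Finset.mem_sdiff, Finset.mem_insert] at hvt ⊢
            tauto
      refine ⟨N' + n * q, fun p hp x hx hxq hv => step n p hp x hx hxq hv ?_⟩
      obtain ⟨a, ha, b, hb, rfl⟩ := ht hwt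
      exact hn a ha b hb (p + 1) x ⟨hxq, G.g_le_fil (lt_add_one p) hx⟩
  obtain ⟨N', hN'⟩ := key t subset_rfl
  exact ⟨N', fun p hp x hx hxq => hN' p hp x hx hxq (by simp)⟩

end GLA

namespace IsPseudoProductGLA

variable {L : Type} [LieRing L] [LieAlgebra ℂ L] {G : GLA L} {e f : Submodule ℂ L}

lemma symm (h : IsPseudoProductGLA G e f) : IsPseudoProductGLA G f e where
  trans := h.trans
  e_ne_bot := h.f_ne_bot
  f_ne_bot := h.e_ne_bot
  sup_eq := by rw [sup_comm, h.sup_eq]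
  inf_eq := by rw [inf_comm, h.inf_eq]
  lie_ee := h.lie_ff
  lie_ff := h.lie_ee
  neg_one_ne_bot := h.neg_one_ne_bot
  generated := h.generated
  depth_bdd := h.depth_bdd
  e_stable := h.f_stable
  f_stable := h.e_stable

lemma e_le (h : IsPseudoProductGLA G e f) : e ≤ G.g (-1) := h.sup_eq ▸ le_sup_left

lemma f_le (h : IsPseudoProductGLA G e f) : f ≤ G.g (-1) := h.sup_eq ▸ le_sup_right

lemma lie_eq_zero_of_mem (h : IsPseudoProductGLA G e f) {x y : L} (hy : y ∈ G.g (-1))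
    (he : ∀ u ∈ e, ⁅u, x⁆ = 0) (hf : ∀ w ∈ f, ⁅w, x⁆ = 0) : ⁅y, x⁆ = 0 := by
  rw [← h.sup_eq] at hy
  obtain ⟨u, hu, w, hw, rfl⟩ := Submodule.mem_sup.1 hy
  rw [add_lie, he u hu, hf w hw, add_zero]

lemma eq_zero_of_forall_lie (h : IsPseudoProductGLA G e f) {p : ℤ} (hp : 0 ≤ p) {x : L}
    (hx : x ∈ G.g p) (hx2 : x ∈ G.lowCentralizer 2) (he : ∀ u ∈ e, ⁅u, x⁆ = 0)
    (hf : ∀ w ∈ f, ⁅w, x⁆ = 0) : x = 0 := by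
  refine h.trans p hp x hx fun q hq y hy => ?_
  rw [← lie_skew, neg_eq_zero]
  rcases eq_or_lt_of_le (Int.le_sub_one_of_lt hq) with rfl | hq
  · exact h.lie_eq_zero_of_mem hy he hf
  · exact hx2 q (by omega) y hy

lemma lie_eq_zero_of_degree_one (h : IsPseudoProductGLA G e f)
    (hnd : ∀ x ∈ G.g (-1), (∀ y ∈ G.g (-1), ⁅x, y⁆ = (0 : L)) → x = 0)
    {x : L} (hx : x ∈ G.g 1) (hx2 : x ∈ G.lowCentralizer 2) {u : L} (hu : u ∈ e) :
    ⁅u, x⁆ = 0 := by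
  have hzero : ∀ v ∈ G.g (-1), ⁅v, x⁆ ∈ G.g 0 := fun v hv => by
    simpa using G.bracket_mem _ _ v hv x hx
  have hux2 := G.lie_mem_lowCentralizer (by omega) (h.e_le hu) hx2
  have hf : ∀ w ∈ f, ⁅w, ⁅u, x⁆⁆ = 0 := by
    intro w hw
    have h1 : ⁅w, ⁅u, x⁆⁆ ∈ f := by
      rw [← lie_skew]
      exact f.neg_mem (h.f_stable _ (hzero u (h.e_le hu)) w hw)
    have h2 : ⁅w, ⁅u, x⁆⁆ ∈ e := by
      rw [G.lie_lie_comm_of_mem_lowCentralizer (by omega) (h.f_le hw) (h.e_le hu) hx2, ← lie_skew]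
      exact e.neg_mem (h.e_stable _ (hzero w (h.f_le hw)) u hu)
    exact (Submodule.mem_bot ℂ).1 (h.inf_eq ▸ ⟨h2, h1⟩)
  refine h.eq_zero_of_forall_lie le_rfl (hzero u (h.e_le hu)) hux2 (fun u' hu' => ?_) hf
  have hmem : ⁅u', ⁅u, x⁆⁆ ∈ e := by
    rw [← lie_skew]
    exact e.neg_mem (h.e_stable _ (hzero u (h.e_le hu)) u' hu')
  refine hnd _ (h.e_le hmem) fun y hy => ?_
  rw [← lie_skew, neg_eq_zero]
  refine h.lie_eq_zero_of_mem hy (fun v hv => h.lie_ee v hv _ hmem) fun w hw => ?_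
  rw [G.lie_lie_comm_of_mem_lowCentralizer (by omega) (h.f_le hw) (h.e_le hu') hux2, hf w hw,
    lie_zero]

lemma eq_zero_of_mem_lowCentralizer_two (h : IsPseudoProductGLA G e f)
    (hnd : ∀ x ∈ G.g (-1), (∀ y ∈ G.g (-1), ⁅x, y⁆ = (0 : L)) → x = 0) :
    ∀ p ≥ (1 : ℤ), ∀ x ∈ G.g p, x ∈ G.lowCentralizer 2 → x = 0 := by
  intro p hp
  induction p, hp using Int.leInduction with
  | base =>
    intro x hx hx2
    exact h.eq_zero_of_forall_lie zero_le_one hx hx2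
      (fun u hu => h.lie_eq_zero_of_degree_one hnd hx hx2 hu)
      (fun w hw => h.symm.lie_eq_zero_of_degree_one hnd hx hx2 hw)
  | succ p hp ih =>
    intro x hx hx2
    have hlie : ∀ y ∈ G.g (-1), ⁅y, x⁆ = 0 := fun y hy =>
      ih _ (by simpa using G.bracket_mem _ _ y hy x hx)
        (G.lie_mem_lowCentralizer (by omega) hy hx2)
    exact h.eq_zero_of_forall_lie (by omega) hx hx2 (fun u hu => hlie u (h.e_le hu))
      (fun w hw => hlie w (h.f_le hw))

end IsPseudoProductGLA

/-- A pseudo-product GLA with non-degenerate negative part is finite-dimensional. -/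
theorem pp_gla_nondegenerate_findim {L : Type} [LieRing L] [LieAlgebra ℂ L]
    (G : GLA L) (e f : Submodule ℂ L) (hpp : IsPseudoProductGLA G e f)
    (hnd : ∀ x ∈ G.g (-1), (∀ y ∈ G.g (-1), ⁅x, y⁆ = (0 : L)) → x = 0) :
    FiniteDimensional ℂ L := by
  obtain ⟨μ, hμ⟩ := hpp.depth_bdd
  have hbdd : ∀ k : ℕ, ∃ N : ℤ, ∀ p ≥ N, ∀ x ∈ G.g p, x ∈ G.lowCentralizer (2 + k) → x = 0 := by
    intro k
    induction k with
    | zero => exact ⟨1, by simpa using hpp.eq_zero_of_mem_lowCentralizer_two hnd⟩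
    | succ k ih =>
      obtain ⟨N, hN⟩ := ih
      have hgen := hpp.generated (1 - (2 + k)) (by omega)
      rw [show (1 - (2 + k) - 1 : ℤ) = -(2 + k) by ring] at hgen
      have := G.lowCentralizer_succ_bounded hμ (by omega) hgen hN
      simpa [add_assoc] using this
  obtain ⟨N, hN⟩ := hbdd μ
  have hfil : G.fil N = ⊤ := by
    refine top_le_iff.1 ?_
    rw [← G.internal.submodule_iSup_eq_top]
    refine iSup_le fun p => ?_
    rcases lt_or_ge p N with h | h
    · exact G.g_le_fil h
    · intro x hx
      rw [hN p h x hx fun r hr y hy => ?_]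
      · exact Submodule.zero_mem _
      · rw [hμ r (by omega), Submodule.mem_bot] at hy
        rw [hy, zero_lie]
  have := G.finiteDimensional_fil hμ N
  rw [hfil] at this
  exact Module.finite_def.2 ((Submodule.fg_top _).1 this.fg_top)
end

section
/- Let (m; e, f) be a free pseudo-product fundamental graded Lie algebra of type (m, n, μ) over ℂ, and let g = ⊕_{p∈ℤ} g_p be the prolongation of (m; e, f). Then g_{-2} is isomorphic to e ⊗ f as a g_0-module; in particular dim g_{-2} = mn. -/
open scoped TensorProduct

namespace GLA

variable {L : Type} [LieRing L] [LieAlgebra ℂ L]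

lemma iSup_eq_top (G : GLA L) : ⨆ p, G.g p = ⊤ :=
  G.internal.submodule_iSup_eq_top

/-- In an FGLA, every bracket lies in the sum of the components of degree other than `-1`. -/
lemma IsFGLA.lie_mem_iSup_ne {G : GLA L} (hG : G.IsFGLA) (x y : L) :
    ⁅x, y⁆ ∈ ⨆ j ≠ (-1 : ℤ), G.g j := by
  have hx : x ∈ ⨆ p, G.g p := by simp [G.iSup_eq_top]
  have hy : y ∈ ⨆ p, G.g p := by simp [G.iSup_eq_top]
  induction hx using Submodule.iSup_induction' with
  | zero => simp
  | add a b _ _ ha hb => rw [add_lie]; exact add_mem ha hb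
  | mem p a ha =>
    induction hy using Submodule.iSup_induction' with
    | zero => simp
    | add c d _ _ hc hd => rw [lie_add]; exact add_mem hc hd
    | mem q b hb =>
      rcases le_or_gt 0 p with hp | hp
      · rw [hG.nonneg p hp, Submodule.mem_bot] at ha
        simp [ha]
      rcases le_or_gt 0 q with hq | hq
      · rw [hG.nonneg q hq, Submodule.mem_bot] at hb
        simp [hb]
      exact Submodule.mem_iSup_of_mem (p + q)
        (Submodule.mem_iSup_of_mem (by omega) (G.bracket_mem p q a ha b hb))

lemma isCompl_iSup_ne (G : GLA L) (p : ℤ) : IsCompl (G.g p) (⨆ j ≠ p, G.g j) := by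
  refine ⟨G.internal.submodule_iSupIndep p, ?_⟩
  rw [codisjoint_iff, eq_top_iff, ← G.iSup_eq_top]
  refine iSup_le fun j => ?_
  by_cases h : j = p
  · exact h ▸ le_sup_left
  · exact le_sup_of_le_right (le_iSup₂_of_le j h le_rfl)

end GLA

/-- An alternating bilinear form on a Lie algebra that vanishes on all brackets, which makes it
a 2-cocycle. -/
structure LieAltForm (L : Type) [LieRing L] [LieAlgebra ℂ L] where
  form : L →ₗ[ℂ] L →ₗ[ℂ] ℂ
  self_eq_zero : ∀ x : L, form x x = 0
  lie_left : ∀ x y z : L, form ⁅x, y⁆ z = 0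

/-- The one-dimensional central extension of `L` defined by the 2-cocycle `ω`. -/
def CentralExt {L : Type} [LieRing L] [LieAlgebra ℂ L] (_ω : LieAltForm L) : Type := L × ℂ

namespace CentralExt

variable {L : Type} [LieRing L] [LieAlgebra ℂ L] (ω : LieAltForm L)

lemma form_lie_right (x y z : L) : ω.form x ⁅y, z⁆ = 0 := by
  have h := ω.self_eq_zero (x + ⁅y, z⁆)
  simpa [ω.self_eq_zero, ω.lie_left] using h

instance : AddCommGroup (CentralExt ω) := inferInstanceAs (AddCommGroup (L × ℂ))

instance : Module ℂ (CentralExt ω) := inferInstanceAs (Module ℂ (L × ℂ))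

/-- The underlying vector space of the central extension. -/
def equivProd : CentralExt ω ≃ₗ[ℂ] L × ℂ := LinearEquiv.refl ℂ (L × ℂ)

instance : Bracket (CentralExt ω) (CentralExt ω) where
  bracket x y := (equivProd ω).symm
    (⁅(equivProd ω x).1, (equivProd ω y).1⁆, ω.form (equivProd ω x).1 (equivProd ω y).1)

@[simp]
lemma equivProd_lie (x y : CentralExt ω) : equivProd ω ⁅x, y⁆ =
    (⁅(equivProd ω x).1, (equivProd ω y).1⁆, ω.form (equivProd ω x).1 (equivProd ω y).1) :=
  (equivProd ω).apply_symm_apply _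

instance : LieRing (CentralExt ω) where
  add_lie x y z := (equivProd ω).injective (by simp)
  lie_add x y z := (equivProd ω).injective (by simp)
  lie_self x := (equivProd ω).injective (by simp [ω.self_eq_zero])
  leibniz_lie x y z := (equivProd ω).injective (by simp [ω.lie_left, form_lie_right])

instance : LieAlgebra ℂ (CentralExt ω) where
  lie_smul t x y := (equivProd ω).injective (by simp)

/-- The degree `p` part of the central extension, the centre being placed in degree `-2`. -/
def gradedPart (G : GLA L) (p : ℤ) : Submodule ℂ (CentralExt ω) :=
  ((G.g p).prod (if p = -2 then ⊤ else ⊥)).comap (equivProd ω).toLinearMap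

variable {ω} in
lemma mem_gradedPart {G : GLA L} {p : ℤ} {x : CentralExt ω} :
    x ∈ gradedPart ω G p ↔ (equivProd ω x).1 ∈ G.g p ∧ (p ≠ -2 → (equivProd ω x).2 = 0) := by
  unfold gradedPart
  split_ifs with h <;> simp [h, Submodule.mem_prod]

lemma gradedPart_isInternal (G : GLA L) : DirectSum.IsInternal (gradedPart ω G) := by
  rw [DirectSum.isInternal_submodule_iff_iSupIndep_and_iSup_eq_top]
  constructor
  · intro p
    rw [Submodule.disjoint_def]
    intro x hx hx'
    have hle : (⨆ j ≠ p, gradedPart ω G j) ≤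
        ((⨆ j ≠ p, G.g j).prod (if p = -2 then ⊥ else ⊤)).comap (equivProd ω).toLinearMap := by
      refine iSup₂_le fun j hj y hy => ?_
      rw [mem_gradedPart] at hy
      refine ⟨Submodule.mem_iSup_of_mem j (Submodule.mem_iSup_of_mem hj hy.1), ?_⟩
      split_ifs with h
      · exact hy.2 (by omega)
      · trivial
    obtain ⟨h1, h2⟩ := hle hx'
    rw [mem_gradedPart] at hx
    apply (equivProd ω).injective
    rw [map_zero]
    refine Prod.ext ?_ ?_
    · exact Submodule.disjoint_def.1 (G.isCompl_iSup_ne p).disjoint _ hx.1 h1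
    · by_cases h : p = -2
      · simpa [h] using h2
      · exact hx.2 h
  · rw [eq_top_iff]
    intro x _
    have hfst : ∀ a : L, (equivProd ω).symm (a, 0) ∈ ⨆ p, gradedPart ω G p := by
      intro a
      have ha : a ∈ ⨆ p, G.g p := by simp [G.iSup_eq_top]
      have hle : (⨆ p, G.g p) ≤ (⨆ p, gradedPart ω G p).comap
          ((equivProd ω).symm.toLinearMap ∘ₗ LinearMap.inl ℂ L ℂ) :=
        iSup_le fun p b hb => Submodule.mem_iSup_of_mem p (by
          rw [mem_gradedPart]
          simpa using hb)
      exact hle ha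
    have hsnd : ∀ c : ℂ, (equivProd ω).symm (0, c) ∈ ⨆ p, gradedPart ω G p := fun c =>
      Submodule.mem_iSup_of_mem (-2) (by rw [mem_gradedPart]; simp)
    have hx := add_mem (hfst (equivProd ω x).1) (hsnd (equivProd ω x).2)
    rw [← map_add] at hx
    simpa using hx

/-- The grading on the central extension by a cocycle supported on degree `-1`. -/
def gla (G : GLA L) (hfd : FiniteDimensional ℂ L)
    (hω : ∀ x ∈ ⨆ j ≠ (-1 : ℤ), G.g j, ∀ y, ω.form x y = 0) : GLA (CentralExt ω) where
  g := gradedPart ω G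
  internal := gradedPart_isInternal ω G
  bracket_mem p q x hx y hy := by
    rw [mem_gradedPart] at hx hy ⊢
    rw [equivProd_lie]
    refine ⟨G.bracket_mem p q _ hx.1 _ hy.1, fun hpq => ?_⟩
    have hmem : ∀ {j : ℤ}, j ≠ -1 → ∀ {a}, a ∈ G.g j → a ∈ ⨆ j ≠ (-1 : ℤ), G.g j :=
      fun hj _ ha => Submodule.mem_iSup_of_mem _ (Submodule.mem_iSup_of_mem hj ha)
    by_cases hp : p = -1
    · have hq : q ≠ -1 := by omega
      have h := ω.self_eq_zero ((equivProd ω x).1 + (equivProd ω y).1)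
      simpa [ω.self_eq_zero, hω _ (hmem hq hy.1)] using h
    · exact hω _ (hmem hp hx.1) _
  findim p := by
    have : FiniteDimensional ℂ (CentralExt ω) := (equivProd ω).symm.finiteDimensional
    infer_instance

variable {ω} {G : GLA L} {hfd : FiniteDimensional ℂ L}
  {hω : ∀ x ∈ ⨆ j ≠ (-1 : ℤ), G.g j, ∀ y, ω.form x y = 0}

lemma mem_gla {p : ℤ} {x : CentralExt ω} : x ∈ (gla ω G hfd hω).g p ↔
    (equivProd ω x).1 ∈ G.g p ∧ (p ≠ -2 → (equivProd ω x).2 = 0) :=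
  mem_gradedPart

variable (ω) in
/-- The linear inclusion of `L` in its central extension. -/
def inl : L →ₗ[ℂ] CentralExt ω := (equivProd ω).symm.toLinearMap ∘ₗ LinearMap.inl ℂ L ℂ

@[simp]
lemma equivProd_inl (x : L) : equivProd ω (inl ω x) = (x, 0) :=
  (equivProd ω).apply_symm_apply _

lemma inl_injective : Function.Injective (inl ω) := fun x y h => by
  simpa using congrArg (equivProd ω) h

lemma map_inl_eq_bot_iff {p : Submodule ℂ L} : p.map (inl ω) = ⊥ ↔ p = ⊥ := by
  rw [← Submodule.map_bot (inl ω), (Submodule.map_injective_of_injective inl_injective).eq_iff]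

lemma inl_mem_gla {p : ℤ} {x : L} (hx : x ∈ G.g p) : inl ω x ∈ (gla ω G hfd hω).g p := by
  simpa [mem_gla] using hx

lemma inl_fst_of_mem_gla {p : ℤ} (hp : p ≠ -2) {x : CentralExt ω}
    (hx : x ∈ (gla ω G hfd hω).g p) : inl ω (equivProd ω x).1 = x :=
  (equivProd ω).injective (Prod.ext (by simp) (by simp [(mem_gla.1 hx).2 hp]))

lemma gla_neg_one : (gla ω G hfd hω).g (-1) = (G.g (-1)).map (inl ω) := by
  ext x
  constructor
  · exact fun hx => ⟨_, (mem_gla.1 hx).1, inl_fst_of_mem_gla (by norm_num) hx⟩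
  · rintro ⟨a, ha, rfl⟩
    exact inl_mem_gla ha

/-- The central extension of an FGLA is again an FGLA as soon as the centre is generated in
degree `-1`. -/
lemma isFGLA_gla (hG : G.IsFGLA)
    (hz : (equivProd ω).symm (0, 1) ∈ Submodule.span ℂ
      {z : CentralExt ω | ∃ x ∈ (gla ω G hfd hω).g (-1), ∃ y ∈ (gla ω G hfd hω).g (-1),
        z = ⁅x, y⁆}) :
    (gla ω G hfd hω).IsFGLA where
  fd := (equivProd ω).symm.finiteDimensional
  nonneg p hp := by
    rw [eq_bot_iff]
    intro x hx
    rw [mem_gla, hG.nonneg p hp, Submodule.mem_bot] at hx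
    exact (equivProd ω).injective (Prod.ext (by simp [hx.1]) (by simp [hx.2 (by omega)]))
  neg_one_ne_bot := by
    rw [gla_neg_one, Ne, map_inl_eq_bot_iff]
    exact hG.neg_one_ne_bot
  generated p hp := by
    apply le_antisymm
    · intro x hx
      have hle : G.g (p - 1) ≤ (Submodule.span ℂ
          {z : CentralExt ω | ∃ x ∈ (gla ω G hfd hω).g p, ∃ y ∈ (gla ω G hfd hω).g (-1),
            z = ⁅x, y⁆} ⊓ (gla ω G hfd hω).g (p - 1)).map
            (LinearMap.fst ℂ L ℂ ∘ₗ (equivProd ω).toLinearMap) := by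
        rw [hG.generated p hp, Submodule.span_le]
        rintro _ ⟨a, ha, b, hb, rfl⟩
        exact ⟨⁅inl ω a, inl ω b⁆,
          ⟨Submodule.subset_span ⟨_, inl_mem_gla ha, _, inl_mem_gla hb, rfl⟩,
            (gla ω G hfd hω).bracket_mem p (-1) _ (inl_mem_gla ha) _ (inl_mem_gla hb)⟩,
          by simp⟩
      obtain ⟨y, ⟨hy, hy'⟩, hxy⟩ := hle (mem_gla.1 hx).1
      have hxy : (equivProd ω y).1 = (equivProd ω x).1 := hxy
      by_cases h : p = -1
      · subst h
        have hsum : x = y +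
            ((equivProd ω x).2 - (equivProd ω y).2) • (equivProd ω).symm (0, 1) :=
          (equivProd ω).injective (Prod.ext (by simp [hxy]) (by simp))
        rw [hsum]
        exact add_mem hy (Submodule.smul_mem _ _ hz)
      · have hp2 : p - 1 ≠ -2 := by omega
        rw [← inl_fst_of_mem_gla hp2 hx, ← hxy, inl_fst_of_mem_gla hp2 hy']
        exact hy
    · rw [Submodule.span_le]
      rintro _ ⟨x, hx, y, hy, rfl⟩
      exact (gla ω G hfd hω).bracket_mem p (-1) x hx y hy

lemma isOfKind_gla {μ : ℕ} (hμ : 2 ≤ μ) (hG : G.IsOfKind μ) : (gla ω G hfd hω).IsOfKind μ := by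
  refine ⟨fun h => hG.1 (eq_bot_iff.2 fun x hx => ?_), fun p hp => eq_bot_iff.2 fun x hx => ?_⟩
  · have hx' := inl_mem_gla (hfd := hfd) (hω := hω) hx
    rw [h, Submodule.mem_bot] at hx'
    exact inl_injective (hx'.trans (map_zero _).symm)
  · rw [mem_gla, hG.2 p hp, Submodule.mem_bot] at hx
    exact (equivProd ω).injective (Prod.ext (by simp [hx.1]) (by simp [hx.2 (by omega)]))

lemma isPPFGLA_gla {e f : Submodule ℂ L} (hG : IsPPFGLA G e f) (hF : (gla ω G hfd hω).IsFGLA)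
    (hee : ∀ x ∈ e, ∀ y ∈ e, ω.form x y = 0) (hff : ∀ x ∈ f, ∀ y ∈ f, ω.form x y = 0) :
    IsPPFGLA (gla ω G hfd hω) (e.map (inl ω)) (f.map (inl ω)) where
  fgla := hF
  e_ne_bot := by
    rw [Ne, map_inl_eq_bot_iff]
    exact hG.e_ne_bot
  f_ne_bot := by
    rw [Ne, map_inl_eq_bot_iff]
    exact hG.f_ne_bot
  sup_eq := by rw [← Submodule.map_sup, hG.sup_eq, gla_neg_one]
  inf_eq := by
    rw [← Submodule.map_inf _ inl_injective, hG.inf_eq, Submodule.map_bot]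
  lie_ee := by
    rintro _ ⟨x, hx, rfl⟩ _ ⟨y, hy, rfl⟩
    exact (equivProd ω).injective (by simp [hG.lie_ee x hx y hy, hee x hx y hy])
  lie_ff := by
    rintro _ ⟨x, hx, rfl⟩ _ ⟨y, hy, rfl⟩
    exact (equivProd ω).injective (by simp [hG.lie_ff x hx y hy, hff x hx y hy])

end CentralExt

namespace IsPPFGLA

variable {L : Type} [LieRing L] [LieAlgebra ℂ L] {G : GLA L} {e f : Submodule ℂ L}

lemma swap (h : IsPPFGLA G e f) : IsPPFGLA G f e where
  fgla := h.fgla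
  e_ne_bot := h.f_ne_bot
  f_ne_bot := h.e_ne_bot
  sup_eq := by rw [sup_comm, h.sup_eq]
  inf_eq := by rw [inf_comm, h.inf_eq]
  lie_ee := h.lie_ff
  lie_ff := h.lie_ee

lemma left_le (h : IsPPFGLA G e f) : e ≤ G.g (-1) := h.sup_eq ▸ le_sup_left

lemma right_le (h : IsPPFGLA G e f) : f ≤ G.g (-1) := h.sup_eq ▸ le_sup_right

lemma isCompl (h : IsPPFGLA G e f) : IsCompl e (f ⊔ ⨆ j ≠ (-1 : ℤ), G.g j) := by
  have hc := G.isCompl_iSup_ne (-1)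
  rw [← h.sup_eq] at hc
  exact ⟨(disjoint_iff.2 h.inf_eq).disjoint_sup_right_of_disjoint_sup_left hc.disjoint,
    codisjoint_assoc.1 hc.codisjoint⟩

/-- The projection onto the first factor of a pseudo-product structure, killing the second factor
and all components of degree other than `-1`. -/
noncomputable def proj (h : IsPPFGLA G e f) : L →ₗ[ℂ] e :=
  Submodule.projectionOnto e _ h.isCompl

lemma proj_left (h : IsPPFGLA G e f) (x : e) : h.proj x = x :=
  Submodule.projectionOnto_apply_left _ x

lemma proj_right (h : IsPPFGLA G e f) {x : L} (hx : x ∈ f) : h.proj x = 0 :=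
  (Submodule.projectionOnto_apply_eq_zero_iff _).2 (Submodule.mem_sup_left hx)

lemma proj_iSup_ne (h : IsPPFGLA G e f) {x : L} (hx : x ∈ ⨆ j ≠ (-1 : ℤ), G.g j) :
    h.proj x = 0 :=
  (Submodule.projectionOnto_apply_eq_zero_iff _).2 (Submodule.mem_sup_right hx)

/-- The bilinear form `(x, y) ↦ Λ (x_e ⊗ y_f)`. -/
noncomputable def tensorForm (h : IsPPFGLA G e f) (Λ : e ⊗[ℂ] f →ₗ[ℂ] ℂ) :
    L →ₗ[ℂ] L →ₗ[ℂ] ℂ :=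
  ((TensorProduct.mk ℂ e f).compr₂ Λ).compl₁₂ h.proj h.swap.proj

lemma tensorForm_apply (h : IsPPFGLA G e f) (Λ : e ⊗[ℂ] f →ₗ[ℂ] ℂ) (x y : L) :
    h.tensorForm Λ x y = Λ (h.proj x ⊗ₜ h.swap.proj y) := rfl

/-- The alternating form `(x, y) ↦ Λ (x_e ⊗ y_f - y_e ⊗ x_f)`. -/
noncomputable def altForm (h : IsPPFGLA G e f) (Λ : e ⊗[ℂ] f →ₗ[ℂ] ℂ) : LieAltForm L where
  form := h.tensorForm Λ - (h.tensorForm Λ).flip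
  self_eq_zero x := by simp
  lie_left x y z := by
    simp [tensorForm_apply, proj_iSup_ne _ (h.fgla.lie_mem_iSup_ne x y)]

lemma altForm_apply (h : IsPPFGLA G e f) (Λ : e ⊗[ℂ] f →ₗ[ℂ] ℂ) (x y : L) :
    (h.altForm Λ).form x y =
      Λ (h.proj x ⊗ₜ h.swap.proj y) - Λ (h.proj y ⊗ₜ h.swap.proj x) := rfl

/-- The bracket of the two factors of a pseudo-product structure, as a map on their tensor
product. -/
noncomputable def lieTensor (_h : IsPPFGLA G e f) : e ⊗[ℂ] f →ₗ[ℂ] L :=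
  TensorProduct.lift (LinearMap.mk₂ ℂ (fun (x : e) (y : f) => ⁅(x : L), (y : L)⁆)
    (by simp) (by simp) (by simp) (by simp))

@[simp]
lemma lieTensor_tmul (h : IsPPFGLA G e f) (x : e) (y : f) :
    h.lieTensor (x ⊗ₜ y) = ⁅(x : L), (y : L)⁆ := rfl

lemma range_lieTensor (h : IsPPFGLA G e f) : LinearMap.range h.lieTensor = G.g (-2) := by
  apply le_antisymm
  · rintro _ ⟨t, rfl⟩
    induction t with
    | zero => simp
    | add s t hs ht => rw [map_add]; exact add_mem hs ht
    | tmul x y =>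
      exact G.bracket_mem (-1) (-1) _ (h.left_le x.2) _ (h.right_le y.2)
  · have hgen := h.fgla.generated (-1) (by norm_num)
    norm_num at hgen
    rw [hgen, Submodule.span_le]
    rintro _ ⟨x, hx, y, hy, rfl⟩
    rw [← h.sup_eq] at hx hy
    obtain ⟨a, ha, b, hb, rfl⟩ := Submodule.mem_sup.1 hx
    obtain ⟨c, hc, d, hd, rfl⟩ := Submodule.mem_sup.1 hy
    refine ⟨(⟨a, ha⟩ : e) ⊗ₜ (⟨d, hd⟩ : f) - (⟨c, hc⟩ : e) ⊗ₜ (⟨b, hb⟩ : f), ?_⟩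
    rw [map_sub, lieTensor_tmul, lieTensor_tmul, add_lie, lie_add, lie_add, h.lie_ee a ha c hc,
      h.lie_ff b hb d hd, ← lie_skew b c]
    abel

end IsPPFGLA

open CentralExt in
/-- In a free pseudo-product FGLA of kind at least two, the bracket is injective on `e ⊗ f`. -/
lemma IsFreePPFGLA.lieTensor_injective {L : Type} [LieRing L] [LieAlgebra ℂ L] {G : GLA L}
    {e f : Submodule ℂ L} {m n μ : ℕ} (hμ : 2 ≤ μ) (hfree : IsFreePPFGLA G e f m n μ) :
    Function.Injective hfree.1.lieTensor := by
  obtain ⟨h, hk, -, -, huniv⟩ := hfree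
  rw [injective_iff_map_eq_zero]
  intro t ht
  by_contra ht0
  obtain ⟨Λ, hΛ⟩ := Module.Projective.exists_dual_eq_one ℂ ht0
  have hω : ∀ x ∈ ⨆ j ≠ (-1 : ℤ), G.g j, ∀ y, (h.altForm Λ).form x y = 0 := by
    intro x hx y
    simp [IsPPFGLA.altForm_apply, IsPPFGLA.proj_iSup_ne _ hx]
  have hef : ∀ (x : e) (y : f), (h.altForm Λ).form x y = Λ (x ⊗ₜ y) := by
    intro x y
    simp [IsPPFGLA.altForm_apply, IsPPFGLA.proj_left, h.proj_right y.2]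
  have hlift : ∀ s : e ⊗[ℂ] f, (equivProd (h.altForm Λ)).symm (h.lieTensor s, Λ s) ∈
      Submodule.span ℂ {z | ∃ x ∈ (gla _ G h.fgla.fd hω).g (-1),
        ∃ y ∈ (gla _ G h.fgla.fd hω).g (-1), z = ⁅x, y⁆} := by
    intro s
    induction s with
    | zero => rw [map_zero, map_zero, ← Prod.zero_eq_mk, map_zero]; exact zero_mem _
    | add a b ha hb =>
      rw [map_add, map_add, ← Prod.mk_add_mk, map_add]
      exact add_mem ha hb
    | tmul x y =>
      refine Submodule.subset_span ⟨inl _ x, inl_mem_gla (h.left_le x.2), inl _ y,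
        inl_mem_gla (h.right_le y.2), (equivProd _).injective ?_⟩
      simp [hef]
  have hF := isFGLA_gla (hfd := h.fgla.fd) (hω := hω) h.fgla (by simpa [ht, hΛ] using hlift t)
  have hPP := isPPFGLA_gla h hF
    (fun x hx y hy => by
      simp [IsPPFGLA.altForm_apply, h.swap.proj_right hx, h.swap.proj_right hy])
    (fun x hx y hy => by
      simp [IsPPFGLA.altForm_apply, h.proj_right hx, h.proj_right hy])
  obtain ⟨Φ, ⟨-, -, hΦ⟩, -⟩ := huniv _ _ _ _ hPP (isOfKind_gla hμ hk)
    ((inl (h.altForm Λ)).restrict fun _ hx => inl_mem_gla hx)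
    (fun y => ⟨⟨_, (mem_gla.1 y.2).1⟩, Subtype.ext (inl_fst_of_mem_gla (by norm_num) y.2)⟩)
    (fun x _ hx => ⟨x, hx, rfl⟩) (fun x _ hx => ⟨x, hx, rfl⟩)
  have hΦ' : ∀ x ∈ G.g (-1), Φ x = inl _ x := fun x hx => hΦ ⟨x, hx⟩
  have hsnd : ∀ s : e ⊗[ℂ] f, (equivProd _ (Φ (h.lieTensor s))).2 = Λ s := by
    intro s
    induction s with
    | zero => simp
    | add a b ha hb => simp [ha, hb]
    | tmul x y =>
      simp [hΦ' _ (h.left_le x.2), hΦ' _ (h.right_le y.2), hef]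
  have hcontra := hsnd t
  simp [ht, hΛ] at hcontra

/-- For the prolongation of a free pseudo-product FGLA of type `(m, n, μ)`,
`g₋₂ ≅ e ⊗ f` as a `g₀`-module (via the bracket map), and `dim g₋₂ = mn`. -/
theorem free_pp_fgla_deg_minus_two {Lm LG : Type} [LieRing Lm] [LieAlgebra ℂ Lm]
    [LieRing LG] [LieAlgebra ℂ LG]
    (M : GLA Lm) (e f : Submodule ℂ Lm) (m n μ : ℕ) (hμ : 2 ≤ μ)
    (hfree : IsFreePPFGLA M e f m n μ)
    (G : GLA LG) (ι : Lm →ₗ⁅ℂ⁆ LG) (hprol : IsPPProlongation M e f G ι) :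
    (∃ T : (TensorProduct ℂ e f) ≃ₗ[ℂ] (G.g (-2)),
      ∀ (x : e) (y : f), ((T (x ⊗ₜ[ℂ] y)) : LG) = ⁅ι (x : Lm), ι (y : Lm)⁆) ∧
    Module.finrank ℂ (G.g (-2)) = m * n := by
  have h := hfree.1
  have hneg : (M.g (-2)).map ι.toLinearMap = G.g (-2) := hprol.graded_neg (-2) (by norm_num)
  let B : e ⊗[ℂ] f →ₗ[ℂ] LG := ι.toLinearMap ∘ₗ h.lieTensor
  have hB : Function.Injective B := hprol.inj.comp (hfree.lieTensor_injective hμ)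
  have hrange : LinearMap.range B = G.g (-2) := by
    rw [LinearMap.range_comp, h.range_lieTensor, hneg]
  let T : e ⊗[ℂ] f ≃ₗ[ℂ] G.g (-2) :=
    (LinearEquiv.ofInjective B hB).trans (LinearEquiv.ofEq _ _ hrange)
  have hT : ∀ t, (T t : LG) = ι (h.lieTensor t) := fun _ => rfl
  refine ⟨⟨T, fun x y => by rw [hT, h.lieTensor_tmul, LieHom.map_lie]⟩, ?_⟩
  rw [← T.finrank_eq, Module.finrank_tensorProduct, hfree.2.2.1, hfree.2.2.2.1]
end

section
/- Let (m; e, f) be a free pseudo-product fundamental graded Lie algebra of type (m, n, μ) over ℂ with μ ≥ 3, and let g = ⊕_{p∈ℤ} g_p be the prolongation of (m; e, f). Then g_{-3} is isomorphic to S²(e) ⊗ f ⊕ S²(f) ⊗ e as a g_0-module; in particular dim g_{-3} = mn(m+n+2)/2. -/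
open scoped TensorProduct

set_option synthInstance.maxHeartbeats 1000000
set_option maxHeartbeats 1000000

section Generated

variable {P : Type} [LieRing P] [LieAlgebra ℂ P]

/-- The span of the left-normed brackets of `k + 1` elements of `V`. -/
def bracketPower (V : Submodule ℂ P) : ℕ → Submodule ℂ P
  | 0 => V
  | k + 1 => Submodule.span ℂ {z | ∃ x ∈ bracketPower V k, ∃ y ∈ V, z = ⁅x, y⁆}

lemma lie_mem_bracketPower (V : Submodule ℂ P) (b : ℕ) :
    ∀ (a : ℕ) (x y : P), x ∈ bracketPower V a → y ∈ bracketPower V b →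
      ⁅x, y⁆ ∈ bracketPower V (a + b + 1) := by
  induction b with
  | zero => exact fun a x y hx hy => Submodule.subset_span ⟨x, hx, y, hy, rfl⟩
  | succ b ih =>
    intro a x y hx hy
    induction hy using Submodule.span_induction with
    | mem z hz =>
      obtain ⟨u, hu, v, hv, rfl⟩ := hz
      have key : ⁅x, ⁅u, v⁆⁆ = ⁅⁅x, u⁆, v⁆ - ⁅⁅x, v⁆, u⁆ := by
        rw [leibniz_lie x u v, ← lie_skew u ⁅x, v⁆, sub_eq_add_neg]
      rw [key]
      refine sub_mem (Submodule.subset_span ⟨_, ih a x u hx hu, v, hv, rfl⟩) ?_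
      have := ih (a + 1) _ u (Submodule.subset_span ⟨x, hx, v, hv, rfl⟩) hu
      rwa [show a + 1 + b + 1 = a + (b + 1) + 1 by ring] at this
    | zero => simp
    | add u v _ _ hu hv => rw [lie_add]; exact add_mem hu hv
    | smul c u _ hu => rw [lie_smul]; exact Submodule.smul_mem _ c hu

/-- The homogeneous components of the subalgebra generated by `V`, placed in degree `-1`. -/
def bracketPiece (V : Submodule ℂ P) : ℤ → Submodule ℂ P
  | .ofNat _ => ⊥
  | .negSucc k => bracketPower V k

lemma lie_mem_bracketPiece (V : Submodule ℂ P) {p q : ℤ} {x y : P}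
    (hx : x ∈ bracketPiece V p) (hy : y ∈ bracketPiece V q) :
    ⁅x, y⁆ ∈ bracketPiece V (p + q) := by
  match p, q with
  | .ofNat a, _ =>
    rw [(Submodule.mem_bot ℂ).1 hx, zero_lie]
    exact zero_mem _
  | .negSucc a, .ofNat b =>
    rw [(Submodule.mem_bot ℂ).1 hy, lie_zero]
    exact zero_mem _
  | .negSucc a, .negSucc b => exact lie_mem_bracketPower V b a x y hx hy

/-- The subalgebra generated by `V`, as the sum of its homogeneous components. -/
def bracketSubalgebra (V : Submodule ℂ P) : LieSubalgebra ℂ P where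
  toSubmodule := ⨆ p, bracketPiece V p
  lie_mem' {x y} hx hy := by
    change x ∈ ⨆ p, bracketPiece V p at hx
    change y ∈ ⨆ p, bracketPiece V p at hy
    change ⁅x, y⁆ ∈ ⨆ p, bracketPiece V p
    refine Submodule.iSup_induction _ (motive := fun x => ⁅x, y⁆ ∈ ⨆ p, bracketPiece V p) hx
      (fun p a ha => ?_) (by simp) (fun a b ha hb => by rw [add_lie]; exact add_mem ha hb)
    refine Submodule.iSup_induction _ (motive := fun y => ⁅a, y⁆ ∈ ⨆ p, bracketPiece V p) hy
      (fun q b hb => ?_) (by simp) (fun b c hb hc => by rw [lie_add]; exact add_mem hb hc)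
    exact Submodule.mem_iSup_of_mem (p + q) (lie_mem_bracketPiece V ha hb)

lemma bracketPiece_le (V : Submodule ℂ P) (p : ℤ) :
    bracketPiece V p ≤ (bracketSubalgebra V).toSubmodule :=
  le_iSup (bracketPiece V) p

lemma map_comap_bracketPiece (V : Submodule ℂ P) (p : ℤ) :
    ((bracketPiece V p).comap (bracketSubalgebra V).toSubmodule.subtype).map
      (bracketSubalgebra V).toSubmodule.subtype = bracketPiece V p := by
  rw [Submodule.map_comap_subtype]
  exact inf_eq_right.2 (bracketPiece_le V p)

/-- The grading of the subalgebra generated by `V`. -/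
def bracketGLA [FiniteDimensional ℂ P] (V : Submodule ℂ P) (hV : iSupIndep (bracketPiece V)) :
    GLA (bracketSubalgebra V) where
  g p := (bracketPiece V p).comap (bracketSubalgebra V).toSubmodule.subtype
  internal := by
    refine DirectSum.isInternal_submodule_of_iSupIndep_of_iSup_eq_top (fun p => ?_) ?_
    · rw [Submodule.disjoint_def]
      intro x hx hx'
      refine Subtype.ext ((Submodule.disjoint_def.1 (hV p)) x hx ?_)
      have : (⨆ q, ⨆ (_ : q ≠ p),
          (bracketPiece V q).comap (bracketSubalgebra V).toSubmodule.subtype) ≤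
          (⨆ q, ⨆ (_ : q ≠ p), bracketPiece V q).comap
            (bracketSubalgebra V).toSubmodule.subtype :=
        iSup₂_le fun q hq => Submodule.comap_mono (le_iSup₂ (f := fun q _ => bracketPiece V q) q hq)
      exact this hx'
    · refine Submodule.map_injective_of_injective
        (bracketSubalgebra V).toSubmodule.injective_subtype ?_
      rw [Submodule.map_iSup, Submodule.map_subtype_top]
      exact iSup_congr (map_comap_bracketPiece V)
  bracket_mem _ _ _ hx _ hy := lie_mem_bracketPiece V hx hy
  findim _ := inferInstance

lemma bracketGLA_isFGLA [FiniteDimensional ℂ P] (V : Submodule ℂ P)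
    (hV : iSupIndep (bracketPiece V)) (hV0 : V ≠ ⊥) : (bracketGLA V hV).IsFGLA where
  fd := inferInstanceAs (FiniteDimensional ℂ (bracketSubalgebra V).toSubmodule)
  nonneg p hp := by
    obtain ⟨k, rfl⟩ := Int.eq_ofNat_of_zero_le hp
    refine (Submodule.eq_bot_iff _).2 fun x hx => Subtype.ext ((Submodule.mem_bot ℂ).1 hx)
  neg_one_ne_bot h := by
    apply hV0
    have := map_comap_bracketPiece V (-1)
    rw [show (bracketPiece V (-1)).comap (bracketSubalgebra V).toSubmodule.subtype = ⊥ from h,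
      Submodule.map_bot] at this
    exact this.symm
  generated p hp := by
    obtain ⟨k, rfl⟩ := Int.eq_negSucc_of_lt_zero hp
    refine Submodule.map_injective_of_injective
      (bracketSubalgebra V).toSubmodule.injective_subtype ?_
    refine (map_comap_bracketPiece V _).trans ?_
    rw [Submodule.map_span]
    change Submodule.span ℂ _ = _
    congr 1
    ext z
    constructor
    · rintro ⟨x, hx, y, hy, rfl⟩
      exact ⟨⁅(⟨x, bracketPiece_le V (.negSucc k) hx⟩ : bracketSubalgebra V),
        (⟨y, bracketPiece_le V (.negSucc 0) hy⟩ : bracketSubalgebra V)⁆,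
        ⟨_, hx, _, hy, rfl⟩, rfl⟩
    · rintro ⟨_, ⟨x, hx, y, hy, rfl⟩, rfl⟩
      exact ⟨x, hx, y, hy, rfl⟩

end Generated

lemma iSupIndep_submodule_prod {ι R A B : Type*} [Ring R] [AddCommGroup A] [Module R A]
    [AddCommGroup B] [Module R B] {p : ι → Submodule R A} {q : ι → Submodule R B}
    (hp : iSupIndep p) (hq : iSupIndep q) : iSupIndep fun i => (p i).prod (q i) := by
  intro i
  rw [Submodule.disjoint_def]
  rintro ⟨a, b⟩ ⟨ha, hb⟩ h
  have hle : (⨆ j, ⨆ (_ : j ≠ i), (p j).prod (q j)) ≤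
      (⨆ j, ⨆ (_ : j ≠ i), p j).prod (⨆ j, ⨆ (_ : j ≠ i), q j) :=
    iSup₂_le fun j hj => Submodule.prod_mono (le_iSup₂ (f := fun j _ => p j) j hj)
      (le_iSup₂ (f := fun j _ => q j) j hj)
  obtain ⟨h₁, h₂⟩ := hle h
  exact Prod.ext (Submodule.disjoint_def.1 (hp i) a ha h₁)
    (Submodule.disjoint_def.1 (hq i) b hb h₂)

namespace IsPPFGLA

variable {L : Type} [LieRing L] [LieAlgebra ℂ L] {M : GLA L} {e f : Submodule ℂ L}

lemma e_le (h : IsPPFGLA M e f) : e ≤ M.g (-1) := h.sup_eq ▸ le_sup_left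

lemma f_le (h : IsPPFGLA M e f) : f ≤ M.g (-1) := h.sup_eq ▸ le_sup_right

/-- The decomposition `g₋₁ = e ⊕ f`. -/
noncomputable def prodEquiv (h : IsPPFGLA M e f) : (e × f) ≃ₗ[ℂ] M.g (-1) :=
  LinearEquiv.ofBijective
    ((e.subtype.coprod f.subtype).codRestrict (M.g (-1))
      fun z => add_mem (h.e_le z.1.2) (h.f_le z.2.2)) <| by
    constructor
    · rw [injective_iff_map_eq_zero]
      rintro ⟨x, y⟩ hxy
      have hxy' : (x : L) + y = 0 := congrArg Subtype.val hxy
      have hx : (x : L) ∈ e ⊓ f :=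
        ⟨x.2, by rw [eq_neg_of_add_eq_zero_left hxy']; exact neg_mem y.2⟩
      rw [h.inf_eq, Submodule.mem_bot] at hx
      rw [hx, zero_add] at hxy'
      exact Prod.ext (Subtype.ext hx) (Subtype.ext hxy')
    · rintro ⟨z, hz⟩
      rw [← h.sup_eq] at hz
      obtain ⟨x, hx, y, hy, rfl⟩ := Submodule.mem_sup.1 hz
      exact ⟨(⟨x, hx⟩, ⟨y, hy⟩), rfl⟩

lemma coe_prodEquiv (h : IsPPFGLA M e f) (z : e × f) :
    (h.prodEquiv z : L) = (z.1 : L) + z.2 := rfl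

end IsPPFGLA

/-- A free pseudo-product FGLA maps to every finite-dimensional graded Lie algebra of depth at
most `μ` (graded by a derivation `D`), by any map on `g₋₁` that makes `e` and `f` abelian. -/
theorem IsFreePPFGLA.exists_lieHom {L K : Type} [LieRing L] [LieAlgebra ℂ L] {M : GLA L}
    {e f : Submodule ℂ L} {m n μ : ℕ} (h : IsFreePPFGLA M e f m n μ) (hμ : 0 < μ)
    [LieRing K] [LieAlgebra ℂ K] [FiniteDimensional ℂ K] (D : Module.End ℂ K)
    (hD : ∀ a b, D ⁅a, b⁆ = ⁅D a, b⁆ + ⁅a, D b⁆)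
    (hK : ∀ p : ℤ, p < -(μ : ℤ) → D.eigenspace (p : ℂ) = ⊥)
    (u : e →ₗ[ℂ] K) (v : f →ₗ[ℂ] K) (hu : ∀ x, D (u x) = -u x) (hv : ∀ y, D (v y) = -v y)
    (huu : ∀ x x', ⁅u x, u x'⁆ = 0) (hvv : ∀ y y', ⁅v y, v y'⁆ = 0) :
    ∃ Φ : L →ₗ⁅ℂ⁆ K, (∀ x : e, Φ x = u x) ∧ ∀ y : f, Φ y = v y := by
  obtain ⟨hM, hkind, -, -, huniv⟩ := h
  have := hM.fgla.fd
  let α : e →ₗ[ℂ] L × K := e.subtype.prod u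
  let β : f →ₗ[ℂ] L × K := f.subtype.prod v
  let V : Submodule ℂ (L × K) := LinearMap.range (α.coprod β)
  have hVsup : LinearMap.range α ⊔ LinearMap.range β = V := (LinearMap.range_coprod α β).symm
  have hαV : LinearMap.range α ≤ V := hVsup ▸ le_sup_left
  have hβV : LinearMap.range β ≤ V := hVsup ▸ le_sup_right
  have hVfst : V.map (LinearMap.fst ℂ L K) = M.g (-1) := by
    rw [← hVsup, Submodule.map_sup, ← LinearMap.range_comp, ← LinearMap.range_comp,
      ← hM.sup_eq]
    exact congrArg₂ _ e.range_subtype f.range_subtype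
  have hpow : ∀ k, bracketPower V k ≤
      (M.g (.negSucc k)).prod (D.eigenspace ((Int.negSucc k : ℤ) : ℂ)) := by
    have h0 : V ≤ (M.g (-1)).prod (D.eigenspace (-1)) := by
      rintro _ ⟨⟨x, y⟩, rfl⟩
      refine ⟨add_mem (hM.e_le x.2) (hM.f_le y.2), ?_⟩
      rw [SetLike.mem_coe, Module.End.mem_eigenspace_iff]
      change D (u x + v y) = (-1 : ℂ) • (u x + v y)
      rw [map_add, hu, hv]
      module
    intro k
    induction k with
    | zero => simpa [bracketPower] using h0
    | succ k ih =>
      refine Submodule.span_le.2 ?_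
      rintro _ ⟨x, hx, y, hy, rfl⟩
      obtain ⟨hx1, hx2⟩ := ih hx
      obtain ⟨hy1, hy2⟩ := h0 hy
      refine ⟨M.bracket_mem (.negSucc k) (-1) _ hx1 _ hy1, ?_⟩
      rw [SetLike.mem_coe, Module.End.mem_eigenspace_iff] at hx2 hy2 ⊢
      change D ⁅x.2, y.2⁆ = _ • ⁅x.2, y.2⁆
      rw [hD, hx2, hy2, smul_lie, lie_smul, ← add_smul]
      congr 1
      push_cast [Int.negSucc_eq]
      ring
  have hpiece : ∀ p, bracketPiece V p ≤ (M.g p).prod (D.eigenspace (p : ℂ)) := by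
    rintro (k | k)
    · exact bot_le
    · exact hpow k
  have hV : iSupIndep (bracketPiece V) :=
    (iSupIndep_submodule_prod M.internal.submodule_iSupIndep
      (D.eigenspaces_iSupIndep.comp (f := fun p : ℤ => (p : ℂ)) Int.cast_injective)).mono hpiece
  have hpowfst : ∀ k, (bracketPower V k).map (LinearMap.fst ℂ L K) = M.g (.negSucc k) := by
    intro k
    induction k with
    | zero => exact hVfst
    | succ k ih =>
      refine Eq.trans ?_ (hM.fgla.generated (.negSucc k) (Int.negSucc_lt_zero k)).symm
      rw [bracketPower, Submodule.map_span]
      congr 1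
      ext z
      constructor
      · rintro ⟨_, ⟨x, hx, y, hy, rfl⟩, rfl⟩
        exact ⟨x.1, ih ▸ ⟨x, hx, rfl⟩, y.1, hVfst ▸ ⟨y, hy, rfl⟩, rfl⟩
      · rintro ⟨x, hx, y, hy, rfl⟩
        rw [← ih] at hx
        rw [← hVfst] at hy
        obtain ⟨x, hx, rfl⟩ := hx
        obtain ⟨y, hy, rfl⟩ := hy
        exact ⟨_, ⟨x, hx, y, hy, rfl⟩, rfl⟩
  have hV0 : V ≠ ⊥ := by
    rintro h0
    rw [h0, Submodule.map_bot] at hVfst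
    exact hM.fgla.neg_one_ne_bot hVfst.symm
  let N := bracketGLA V hV
  let s := (bracketSubalgebra V).toSubmodule.subtype
  have hs : Function.Injective s := (bracketSubalgebra V).toSubmodule.injective_subtype
  have hVS : V ≤ (bracketSubalgebra V).toSubmodule := bracketPiece_le V (.negSucc 0)
  have hms : ∀ W ≤ V, (W.comap s).map s = W := fun W hW => by
    rw [Submodule.map_comap_subtype]
    exact inf_eq_right.2 (hW.trans hVS)
  have hNpp : IsPPFGLA N ((LinearMap.range α).comap s) ((LinearMap.range β).comap s) :=
    { fgla := bracketGLA_isFGLA V hV hV0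
      e_ne_bot := fun h0 => by
        have h1 := hms _ hαV
        rw [h0, Submodule.map_bot] at h1
        refine hM.e_ne_bot ((Submodule.eq_bot_iff _).2 fun x hx => ?_)
        have : α ⟨x, hx⟩ ∈ LinearMap.range α := ⟨_, rfl⟩
        rw [← h1, Submodule.mem_bot] at this
        exact congrArg Prod.fst this
      f_ne_bot := fun h0 => by
        have h1 := hms _ hβV
        rw [h0, Submodule.map_bot] at h1
        refine hM.f_ne_bot ((Submodule.eq_bot_iff _).2 fun x hx => ?_)
        have : β ⟨x, hx⟩ ∈ LinearMap.range β := ⟨_, rfl⟩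
        rw [← h1, Submodule.mem_bot] at this
        exact congrArg Prod.fst this
      sup_eq := by
        refine Submodule.map_injective_of_injective hs ?_
        rw [Submodule.map_sup, hms _ hαV, hms _ hβV, hVsup]
        exact (hms V le_rfl).symm
      inf_eq := by
        refine (Submodule.eq_bot_iff _).2 ?_
        rintro z ⟨⟨x, hx⟩, ⟨y, hy⟩⟩
        have hxy : (x : L) = y := congrArg Prod.fst (hx.trans hy.symm)
        have hx0 : (x : L) ∈ e ⊓ f := ⟨x.2, hxy ▸ y.2⟩
        rw [hM.inf_eq, Submodule.mem_bot] at hx0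
        have hx0' : x = 0 := Subtype.ext hx0
        rw [hx0', map_zero] at hx
        exact hs (hx.symm.trans (map_zero s).symm)
      lie_ee := by
        rintro a ⟨x, hx⟩ b ⟨y, hy⟩
        refine Subtype.ext ?_
        change ⁅s a, s b⁆ = 0
        rw [← hx, ← hy]
        exact Prod.ext (hM.lie_ee _ x.2 _ y.2) (huu x y)
      lie_ff := by
        rintro a ⟨x, hx⟩ b ⟨y, hy⟩
        refine Subtype.ext ?_
        change ⁅s a, s b⁆ = 0
        rw [← hx, ← hy]
        exact Prod.ext (hM.lie_ff _ x.2 _ y.2) (hvv x y) }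
  have hNkind : N.IsOfKind μ := by
    constructor
    · intro h0
      obtain ⟨k, rfl⟩ := Nat.exists_eq_succ_of_ne_zero hμ.ne'
      refine hkind.1 ((hpowfst k).symm.trans ?_)
      have h1 : (bracketPower V k) = ⊥ := by
        refine (map_comap_bracketPiece V (.negSucc k)).symm.trans ?_
        refine (congrArg (Submodule.map s) h0).trans (Submodule.map_bot s)
      rw [h1, Submodule.map_bot]
    · intro p hp
      refine (Submodule.eq_bot_iff _).2 fun x hx => hs ?_
      have h1 := hpiece p hx
      rw [hkind.2 p hp, hK p hp, Submodule.prod_bot, Submodule.mem_bot] at h1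
      exact h1.trans (map_zero s).symm
  let γ : (e × f) →ₗ[ℂ] N.g (-1) :=
    LinearMap.codRestrict (N.g (-1))
      (LinearMap.codRestrict (bracketSubalgebra V).toSubmodule (α.coprod β)
        fun z => hVS ⟨z, rfl⟩) fun z => (⟨z, rfl⟩ : (α.coprod β) z ∈ V)
  have hγ : Function.Surjective γ := by
    rintro ⟨x, hx⟩
    obtain ⟨z, hz⟩ : s x ∈ V := hx
    exact ⟨z, Subtype.ext (hs hz)⟩
  obtain ⟨Ψ, ⟨-, -, hΨ⟩, -⟩ := huniv _ N _ _ hNpp hNkind (γ ∘ₗ hM.prodEquiv.symm.toLinearMap)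
    (hγ.comp hM.prodEquiv.symm.surjective)
    (fun x hx hxe => by
      have : (⟨x, hx⟩ : M.g (-1)) = hM.prodEquiv (⟨x, hxe⟩, 0) :=
        Subtype.ext (by simp [hM.coe_prodEquiv])
      rw [this, LinearMap.comp_apply, LinearEquiv.coe_coe, LinearEquiv.symm_apply_apply]
      refine ⟨⟨x, hxe⟩, ?_⟩
      change α ⟨x, hxe⟩ = α ⟨x, hxe⟩ + β 0
      simp)
    (fun x hx hxf => by
      have : (⟨x, hx⟩ : M.g (-1)) = hM.prodEquiv (0, ⟨x, hxf⟩) :=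
        Subtype.ext (by simp [hM.coe_prodEquiv])
      rw [this, LinearMap.comp_apply, LinearEquiv.coe_coe, LinearEquiv.symm_apply_apply]
      refine ⟨⟨x, hxf⟩, ?_⟩
      change β ⟨x, hxf⟩ = α 0 + β ⟨x, hxf⟩
      simp)
  have hΨ' : ∀ z : e × f, ((Ψ ((z.1 : L) + z.2) : bracketSubalgebra V) : L × K) =
      α z.1 + β z.2 := by
    intro z
    rw [← hM.coe_prodEquiv, hΨ, LinearMap.comp_apply, LinearEquiv.coe_coe,
      LinearEquiv.symm_apply_apply]
    rfl
  refine ⟨(LieHom.snd ℂ L K).comp ((bracketSubalgebra V).incl.comp Ψ), fun x => ?_, fun y => ?_⟩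
  · have := congrArg Prod.snd (hΨ' (x, 0))
    simpa [α, β] using this
  · have := congrArg Prod.snd (hΨ' (0, y))
    simpa [α, β] using this

section Model

variable (E F : Type) [AddCommGroup E] [Module ℂ E] [AddCommGroup F] [Module ℂ F]

/-- The nilpotent graded Lie algebra `E ⋉ (F ⊕ E ⊗ F ⊕ (E ⊗ E) ⊗ F)` in which the abelian Lie
algebra `E` acts by (symmetrized) multiplication. -/
@[ext]
structure SymModel : Type where
  left : E
  right : F
  two : E ⊗[ℂ] F
  three : (E ⊗[ℂ] E) ⊗[ℂ] F

namespace SymModel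

/-- The underlying vector space of `SymModel E F`. -/
def equivProd : SymModel E F ≃ E × F × (E ⊗[ℂ] F) × ((E ⊗[ℂ] E) ⊗[ℂ] F) where
  toFun a := (a.left, a.right, a.two, a.three)
  invFun a := ⟨a.1, a.2.1, a.2.2.1, a.2.2.2⟩

noncomputable instance : AddCommGroup (SymModel E F) := (equivProd E F).addCommGroup

noncomputable instance : Module ℂ (SymModel E F) := (equivProd E F).module ℂ

instance [FiniteDimensional ℂ E] [FiniteDimensional ℂ F] : FiniteDimensional ℂ (SymModel E F) :=
  Module.Finite.equiv ((equivProd E F).linearEquiv ℂ).symm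

/-- The symmetrized multiplication `x, x' ⊗ y ↦ (x ⊗ x' + x' ⊗ x) ⊗ y`. -/
noncomputable def mul : E →ₗ[ℂ] (E ⊗[ℂ] F) →ₗ[ℂ] ((E ⊗[ℂ] E) ⊗[ℂ] F) :=
  LinearMap.rTensorHom F ∘ₗ (TensorProduct.mk ℂ E E + (TensorProduct.mk ℂ E E).flip)

variable {E F}

lemma mul_tmul (x x' : E) (y : F) :
    mul E F x (x' ⊗ₜ y) = (x ⊗ₜ[ℂ] x' + x' ⊗ₜ[ℂ] x) ⊗ₜ[ℂ] y := rfl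

lemma mul_tmul_comm (x x' : E) (y : F) : mul E F x (x' ⊗ₜ y) = mul E F x' (x ⊗ₜ y) := by
  rw [mul_tmul, mul_tmul, add_comm]

@[simp] lemma left_add (a b : SymModel E F) : (a + b).left = a.left + b.left := rfl
@[simp] lemma right_add (a b : SymModel E F) : (a + b).right = a.right + b.right := rfl
@[simp] lemma two_add (a b : SymModel E F) : (a + b).two = a.two + b.two := rfl
@[simp] lemma three_add (a b : SymModel E F) : (a + b).three = a.three + b.three := rfl
@[simp] lemma left_neg (a : SymModel E F) : (-a).left = -a.left := rfl
@[simp] lemma right_neg (a : SymModel E F) : (-a).right = -a.right := rfl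
@[simp] lemma two_neg (a : SymModel E F) : (-a).two = -a.two := rfl
@[simp] lemma three_neg (a : SymModel E F) : (-a).three = -a.three := rfl
@[simp] lemma left_smul (c : ℂ) (a : SymModel E F) : (c • a).left = c • a.left := rfl
@[simp] lemma right_smul (c : ℂ) (a : SymModel E F) : (c • a).right = c • a.right := rfl
@[simp] lemma two_smul (c : ℂ) (a : SymModel E F) : (c • a).two = c • a.two := rfl
@[simp] lemma three_smul (c : ℂ) (a : SymModel E F) : (c • a).three = c • a.three := rfl
@[simp] lemma left_zero : (0 : SymModel E F).left = 0 := rfl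
@[simp] lemma right_zero : (0 : SymModel E F).right = 0 := rfl
@[simp] lemma two_zero : (0 : SymModel E F).two = 0 := rfl
@[simp] lemma three_zero : (0 : SymModel E F).three = 0 := rfl

noncomputable instance : Bracket (SymModel E F) (SymModel E F) where
  bracket a b := ⟨0, 0, a.left ⊗ₜ b.right - b.left ⊗ₜ a.right,
    mul E F a.left b.two - mul E F b.left a.two⟩

@[simp] lemma left_lie (a b : SymModel E F) : ⁅a, b⁆.left = 0 := rfl
@[simp] lemma right_lie (a b : SymModel E F) : ⁅a, b⁆.right = 0 := rfl
@[simp] lemma two_lie (a b : SymModel E F) :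
    ⁅a, b⁆.two = a.left ⊗ₜ b.right - b.left ⊗ₜ a.right := rfl
@[simp] lemma three_lie (a b : SymModel E F) :
    ⁅a, b⁆.three = mul E F a.left b.two - mul E F b.left a.two := rfl

noncomputable instance : LieRing (SymModel E F) where
  add_lie a b c := by
    ext <;> simp [TensorProduct.add_tmul, TensorProduct.tmul_add] <;> abel
  lie_add a b c := by
    ext <;> simp [TensorProduct.add_tmul, TensorProduct.tmul_add] <;> abel
  lie_self a := by ext <;> simp
  leibniz_lie a b c := by
    ext
    · simp
    · simp
    · simp
    · simp only [three_add, left_lie, two_lie,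
        three_lie, map_sub, map_zero, LinearMap.zero_apply, zero_sub, sub_zero]
      rw [mul_tmul_comm c.left a.left, mul_tmul_comm c.left b.left, mul_tmul_comm b.left a.left]
      abel

noncomputable instance : LieAlgebra ℂ (SymModel E F) where
  lie_smul c a b := by
    ext <;> simp [← TensorProduct.smul_tmul', smul_sub]

variable (E F) in
/-- The derivation of `SymModel E F` that defines its grading. -/
@[simps]
noncomputable def degree : Module.End ℂ (SymModel E F) where
  toFun a := ⟨-a.left, -a.right, (-2 : ℂ) • a.two, (-3 : ℂ) • a.three⟩
  map_add' a b := by ext <;> simp only [left_add, right_add, two_add, three_add] <;> module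
  map_smul' c a := by
    ext <;> simp only [left_smul, right_smul, two_smul, three_smul, RingHom.id_apply] <;> module

lemma degree_lie (a b : SymModel E F) :
    degree E F ⁅a, b⁆ = ⁅degree E F a, b⁆ + ⁅a, degree E F b⁆ := by
  ext
  · simp
  · simp
  · simp only [degree_apply_two, degree_apply_left, degree_apply_right, two_add,
      two_lie, TensorProduct.neg_tmul, TensorProduct.tmul_neg]
    module
  · simp only [degree_apply_two, degree_apply_three, degree_apply_left, three_add,
      three_lie, map_neg, LinearMap.neg_apply, map_smul]
    module

lemma eigenspace_degree {p : ℤ} (hp : p < -3) : (degree E F).eigenspace (p : ℂ) = ⊥ := by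
  refine (Submodule.eq_bot_iff _).2 fun a ha => ?_
  rw [Module.End.mem_eigenspace_iff] at ha
  have key : ∀ (q : ℤ), -3 ≤ q → ∀ {W : Type} [AddCommGroup W] [Module ℂ W] (w : W),
      (q : ℂ) • w = (p : ℂ) • w → w = 0 := by
    intro q hq W _ _ w hw
    have hne : (q : ℂ) - p ≠ 0 := by
      rw [sub_ne_zero]
      exact_mod_cast (hp.trans_le hq).ne'
    rw [← sub_eq_zero, ← sub_smul] at hw
    exact (smul_eq_zero.1 hw).resolve_left hne
  have h₁ := congrArg left ha
  have h₂ := congrArg right ha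
  have h₃ := congrArg two ha
  have h₄ := congrArg three ha
  refine SymModel.ext (key (-1) (by norm_num) _ ?_) (key (-1) (by norm_num) _ ?_)
    (key (-2) (by norm_num) _ ?_) (key (-3) (by norm_num) _ ?_)
  · simpa using h₁
  · simpa using h₂
  · simpa using h₃
  · rw [Int.cast_neg, Int.cast_ofNat]
    exact h₄

variable (E F) in
/-- The inclusion of `E`. -/
@[simps]
noncomputable def inl : E →ₗ[ℂ] SymModel E F where
  toFun x := ⟨x, 0, 0, 0⟩
  map_add' x y := by ext <;> simp
  map_smul' c x := by ext <;> simp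

variable (E F) in
/-- The inclusion of `F`. -/
@[simps]
noncomputable def inr : F →ₗ[ℂ] SymModel E F where
  toFun y := ⟨0, y, 0, 0⟩
  map_add' x y := by ext <;> simp
  map_smul' c x := by ext <;> simp

lemma lie_inl_inl (x x' : E) : ⁅inl E F x, inl E F x'⁆ = 0 := by
  ext <;> simp

lemma lie_inr_inr (y y' : F) : ⁅inr E F y, inr E F y'⁆ = 0 := by
  ext <;> simp

lemma degree_inl (x : E) : degree E F (inl E F x) = -inl E F x := by
  ext <;> simp

lemma degree_inr (y : F) : degree E F (inr E F y) = -inr E F y := by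
  ext <;> simp

lemma three_lie_lie_inl (x x' : E) (y : F) : (⁅⁅inl E F x, inr E F y⁆, inl E F x'⁆).three =
    -((x ⊗ₜ x' + x' ⊗ₜ x) ⊗ₜ y) := by
  simp [-lie_lie, mul_tmul, add_comm]

lemma three_lie_lie_inr (x : E) (y y' : F) :
    (⁅⁅inr E F y, inl E F x⁆, inr E F y'⁆).three = 0 := by
  simp [-lie_lie]

variable (E F) in
/-- The projection onto the component of degree `-3`. -/
noncomputable def threeHom : SymModel E F →ₗ[ℂ] (E ⊗[ℂ] E) ⊗[ℂ] F where
  toFun := three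
  map_add' _ _ := rfl
  map_smul' _ _ := rfl

end SymModel

end Model

section SymSq

variable {V : Type} [AddCommGroup V] [Module ℂ V]

lemma comm_symSq (w : symSq V) : TensorProduct.comm ℂ V V w = (w : V ⊗[ℂ] V) := w.2

lemma tmul_add_tmul_mem_symSq (x x' : V) : x ⊗ₜ[ℂ] x' + x' ⊗ₜ[ℂ] x ∈ symSq V := by
  change TensorProduct.comm ℂ V V (x ⊗ₜ[ℂ] x' + x' ⊗ₜ[ℂ] x) = x ⊗ₜ[ℂ] x' + x' ⊗ₜ[ℂ] x
  simp [add_comm]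

lemma finrank_symSq [FiniteDimensional ℂ V] :
    Module.finrank ℂ (symSq V) = (Module.finrank ℂ V + 1).choose 2 := by
  let b := Module.finBasis ℂ V
  let B := (b.tensorProduct b).equivFun
  let κ : (Sym2 (Fin (Module.finrank ℂ V)) → ℂ) →ₗ[ℂ] V ⊗[ℂ] V :=
    B.symm.toLinearMap ∘ₗ LinearMap.funLeft ℂ ℂ fun p => s(p.1, p.2)
  have hκ : Function.Injective κ := B.symm.injective.comp <|
    LinearMap.funLeft_injective_of_surjective _ _ _ fun z => by
      induction z with | _ i j => exact ⟨(i, j), rfl⟩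
  have hB : ∀ w i j, B (TensorProduct.comm ℂ V V w) (i, j) = B w (j, i) := by
    intro w i j
    induction w with
    | zero => simp
    | tmul x y => simp [B, mul_comm]
    | add x y hx hy => simp only [map_add, Pi.add_apply, hx, hy]
  have hrange : LinearMap.range κ = symSq V := by
    ext w
    constructor
    · rintro ⟨h, rfl⟩
      refine B.injective (funext fun ⟨i, j⟩ => ?_)
      refine (hB _ i j).trans ?_
      simp [κ, LinearMap.funLeft_apply, Sym2.eq_swap]
    · intro hw
      have hw' : ∀ i j, B w (i, j) = B w (j, i) := fun i j => by
        rw [← hB, comm_symSq ⟨w, hw⟩]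
      refine ⟨Sym2.lift ⟨fun i j => B w (i, j), hw'⟩, B.injective ?_⟩
      ext ⟨i, j⟩
      simp [κ, LinearMap.funLeft_apply]
  rw [← hrange, LinearMap.finrank_range_of_inj hκ, Module.finrank_fintype_fun_eq_card, Sym2.card,
    Fintype.card_fin]

lemma two_mul_finrank_symSq_tensorProduct_prod {W : Type} [AddCommGroup W] [Module ℂ W]
    [FiniteDimensional ℂ V] [FiniteDimensional ℂ W] :
    2 * Module.finrank ℂ ((symSq V ⊗[ℂ] W) × (symSq W ⊗[ℂ] V)) =
      Module.finrank ℂ V * Module.finrank ℂ W * (Module.finrank ℂ V + Module.finrank ℂ W + 2) := by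
  rw [Module.finrank_prod, Module.finrank_tensorProduct, Module.finrank_tensorProduct,
    finrank_symSq, finrank_symSq]
  have hV := Nat.add_one_mul_choose_eq (Module.finrank ℂ V) 1
  have hW := Nat.add_one_mul_choose_eq (Module.finrank ℂ W) 1
  rw [Nat.choose_one_right] at hV hW
  zify at hV hW ⊢
  linear_combination (-Module.finrank ℂ W : ℤ) * hV - Module.finrank ℂ V * hW

end SymSq

section Triple

set_option maxSynthPendingDepth 3

variable {L : Type} [LieRing L] [LieAlgebra ℂ L]

/-- The linear map `(x ⊗ x') ⊗ y ↦ ⁅⁅x, y⁆, x'⁆`. -/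
noncomputable def tripleLie (e f : Submodule ℂ L) : (e ⊗[ℂ] e) ⊗[ℂ] f →ₗ[ℂ] L :=
  TensorProduct.lift <| TensorProduct.lift <| LinearMap.mk₂ ℂ
    (fun x x' => -((LieAlgebra.ad ℂ L (x' : L) ∘ₗ LieAlgebra.ad ℂ L (x : L)) ∘ₗ f.subtype))
    (fun x₁ x₂ x' => by ext; simp [add_comm]) (fun c x x' => by ext; simp)
    (fun x x₁ x₂ => by ext; simp [add_comm]) (fun c x x' => by ext; simp)

lemma tripleLie_tmul {e f : Submodule ℂ L} (x x' : e) (y : f) :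
    tripleLie e f ((x ⊗ₜ x') ⊗ₜ y) = ⁅⁅(x : L), (y : L)⁆, (x' : L)⁆ := by
  rw [← lie_skew]
  rfl

/-- The restriction of `tripleLie` to symmetric tensors. -/
noncomputable def symTripleLie (e f : Submodule ℂ L) : symSq e ⊗[ℂ] f →ₗ[ℂ] L :=
  tripleLie e f ∘ₗ (symSq e).subtype.rTensor f

lemma symTripleLie_tmul {e f : Submodule ℂ L} (w : symSq e) (y : f) :
    symTripleLie e f (w ⊗ₜ y) = tripleLie e f ((w : e ⊗[ℂ] e) ⊗ₜ y) := rfl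

namespace IsPPFGLA

variable {M : GLA L} {e f : Submodule ℂ L}

lemma symm (h : IsPPFGLA M e f) : IsPPFGLA M f e where
  fgla := h.fgla
  e_ne_bot := h.f_ne_bot
  f_ne_bot := h.e_ne_bot
  sup_eq := sup_comm e f ▸ h.sup_eq
  inf_eq := inf_comm e f ▸ h.inf_eq
  lie_ee := h.lie_ff
  lie_ff := h.lie_ee

lemma tripleLie_mem (h : IsPPFGLA M e f) (z : (e ⊗[ℂ] e) ⊗[ℂ] f) :
    tripleLie e f z ∈ M.g (-3) := by
  induction z with
  | zero => simp
  | add a b ha hb => rw [map_add]; exact add_mem ha hb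
  | tmul w y =>
    induction w with
    | zero => simp
    | add a b ha hb => rw [TensorProduct.add_tmul, map_add]; exact add_mem ha hb
    | tmul x x' =>
      rw [tripleLie_tmul]
      exact M.bracket_mem (-2) (-1) _
        (M.bracket_mem (-1) (-1) _ (h.e_le x.2) _ (h.f_le y.2)) _ (h.e_le x'.2)

lemma lie_lie_mem_range (h : IsPPFGLA M e f) {x x' y : L} (hx : x ∈ e) (hx' : x' ∈ e)
    (hy : y ∈ f) : ⁅⁅x, y⁆, x'⁆ ∈ LinearMap.range (symTripleLie e f) := by
  lift x to e using hx
  lift x' to e using hx'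
  lift y to f using hy
  have hcomm : ⁅⁅(x' : L), (y : L)⁆, (x : L)⁆ = ⁅⁅(x : L), (y : L)⁆, (x' : L)⁆ := by
    rw [lie_lie (x : L), h.lie_ee _ x.2 _ x'.2, lie_zero, sub_zero, ← lie_skew,
      ← lie_skew _ (x' : L), lie_neg]
  refine ⟨(2⁻¹ : ℂ) • ((⟨x ⊗ₜ x' + x' ⊗ₜ x, tmul_add_tmul_mem_symSq x x'⟩ : symSq e) ⊗ₜ y), ?_⟩
  rw [map_smul, symTripleLie_tmul, TensorProduct.add_tmul, map_add, tripleLie_tmul,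
    tripleLie_tmul, hcomm]
  module

lemma range_coprod_symTripleLie (h : IsPPFGLA M e f) :
    LinearMap.range ((symTripleLie e f).coprod (symTripleLie f e)) = M.g (-3) := by
  rw [LinearMap.range_coprod]
  apply le_antisymm
  · refine sup_le ?_ ?_
    · rintro _ ⟨z, rfl⟩
      exact h.tripleLie_mem _
    · rintro _ ⟨z, rfl⟩
      exact h.symm.tripleLie_mem _
  set R := LinearMap.range (symTripleLie e f) ⊔ LinearMap.range (symTripleLie f e)
  have hR : ∀ x ∈ e, ∀ y ∈ f, ∀ c ∈ M.g (-1), ⁅⁅x, y⁆, c⁆ ∈ R := by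
    intro x hx y hy c hc
    rw [← h.sup_eq] at hc
    obtain ⟨x', hx', y', hy', rfl⟩ := Submodule.mem_sup.1 hc
    rw [lie_add]
    refine add_mem (Submodule.mem_sup_left (h.lie_lie_mem_range hx hx' hy)) ?_
    rw [← lie_skew x y, neg_lie]
    exact neg_mem (Submodule.mem_sup_right (h.symm.lie_lie_mem_range hy hy' hx))
  refine (h.fgla.generated (-2) (by norm_num)).trans_le (Submodule.span_le.2 ?_)
  rintro _ ⟨a, ha, c, hc, rfl⟩
  have ha' := (h.fgla.generated (-1) (by norm_num)).le ha
  induction ha' using Submodule.span_induction with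
  | zero => simp
  | add u v hu hv hu' hv' =>
    rw [add_lie]
    refine add_mem (hu' ?_) (hv' ?_)
    · exact (h.fgla.generated (-1) (by norm_num)).ge hu
    · exact (h.fgla.generated (-1) (by norm_num)).ge hv
  | smul r u hu hu' =>
    rw [smul_lie]
    exact Submodule.smul_mem _ r (hu' ((h.fgla.generated (-1) (by norm_num)).ge hu))
  | mem z hz =>
    obtain ⟨p, hp, q, hq, rfl⟩ := hz
    rw [← h.sup_eq] at hp hq
    obtain ⟨x₁, hx₁, y₁, hy₁, rfl⟩ := Submodule.mem_sup.1 hp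
    obtain ⟨x₂, hx₂, y₂, hy₂, rfl⟩ := Submodule.mem_sup.1 hq
    have : ⁅x₁ + y₁, x₂ + y₂⁆ = ⁅x₁, y₂⁆ - ⁅x₂, y₁⁆ := by
      rw [add_lie, lie_add, lie_add, h.lie_ee _ hx₁ _ hx₂, h.lie_ff _ hy₁ _ hy₂,
        ← lie_skew x₂ y₁]
      abel
    rw [this, sub_lie]
    exact sub_mem (hR _ hx₁ _ hy₂ _ hc) (hR _ hx₂ _ hy₁ _ hc)

end IsPPFGLA

section Hom

variable {e f : Submodule ℂ L} {Φ : L →ₗ⁅ℂ⁆ SymModel e f}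

lemma three_map_symTripleLie (he : ∀ x : e, Φ x = SymModel.inl e f x)
    (hf : ∀ y : f, Φ y = SymModel.inr e f y) (w : symSq e ⊗[ℂ] f) :
    (Φ (symTripleLie e f w)).three = (-2 : ℂ) • (symSq e).subtype.rTensor f w := by
  have key : SymModel.threeHom e f ∘ₗ Φ.toLinearMap ∘ₗ tripleLie e f =
      -(LinearMap.id + (TensorProduct.comm ℂ e e).toLinearMap.rTensor f) := by
    refine TensorProduct.ext_threefold fun x x' y => ?_
    change (Φ (tripleLie e f ((x ⊗ₜ x') ⊗ₜ y))).three = _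
    rw [tripleLie_tmul, LieHom.map_lie, LieHom.map_lie, he, hf, he, SymModel.three_lie_lie_inl,
      TensorProduct.add_tmul]
    rfl
  have hcomm : (TensorProduct.comm ℂ e e).toLinearMap ∘ₗ (symSq e).subtype = (symSq e).subtype :=
    LinearMap.ext comm_symSq
  have := LinearMap.congr_fun key ((symSq e).subtype.rTensor f w)
  refine this.trans ?_
  rw [LinearMap.neg_apply, LinearMap.add_apply, LinearMap.id_apply, ← LinearMap.comp_apply,
    ← LinearMap.rTensor_comp, hcomm]
  module

lemma three_map_symTripleLie_swap (he : ∀ x : e, Φ x = SymModel.inl e f x)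
    (hf : ∀ y : f, Φ y = SymModel.inr e f y) (w : symSq f ⊗[ℂ] e) :
    (Φ (symTripleLie f e w)).three = 0 := by
  have key : SymModel.threeHom e f ∘ₗ Φ.toLinearMap ∘ₗ tripleLie f e = 0 := by
    refine TensorProduct.ext_threefold fun y y' x => ?_
    change (Φ (tripleLie f e ((y ⊗ₜ y') ⊗ₜ x))).three = _
    rw [tripleLie_tmul, LieHom.map_lie, LieHom.map_lie, he, hf, hf, SymModel.three_lie_lie_inr]
    rfl
  exact LinearMap.congr_fun key _

lemma eq_zero_of_symTripleLie_add_eq_zero (he : ∀ x : e, Φ x = SymModel.inl e f x)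
    (hf : ∀ y : f, Φ y = SymModel.inr e f y) {w : symSq e ⊗[ℂ] f} {w' : symSq f ⊗[ℂ] e}
    (h : symTripleLie e f w + symTripleLie f e w' = 0) : w = 0 := by
  have h3 : (Φ (symTripleLie e f w + symTripleLie f e w')).three = 0 := by
    rw [h, map_zero, SymModel.three_zero]
  rw [map_add, SymModel.three_add, three_map_symTripleLie he hf,
    three_map_symTripleLie_swap he hf, add_zero, smul_eq_zero] at h3
  refine (injective_iff_map_eq_zero _).1 (Module.Flat.rTensor_preserves_injective_linearMap (M := f)
    (symSq e).subtype (symSq e).injective_subtype) w (h3.resolve_left (by norm_num))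

end Hom

lemma IsFreePPFGLA.injective_coprod_symTripleLie {M : GLA L} {e f : Submodule ℂ L} {m n μ : ℕ}
    (hμ : 3 ≤ μ) (h : IsFreePPFGLA M e f m n μ) :
    Function.Injective ((symTripleLie e f).coprod (symTripleLie f e)) := by
  have := h.1.fgla.fd
  have hdeg : ∀ (E F : Type) [AddCommGroup E] [Module ℂ E] [AddCommGroup F] [Module ℂ F] (p : ℤ),
      p < -(μ : ℤ) → (SymModel.degree E F).eigenspace (p : ℂ) = ⊥ := fun E F _ _ _ _ p hp =>
    SymModel.eigenspace_degree (by omega)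
  obtain ⟨Φ, hΦe, hΦf⟩ := h.exists_lieHom (by omega) (SymModel.degree e f) SymModel.degree_lie
    (hdeg e f) (SymModel.inl e f) (SymModel.inr e f) SymModel.degree_inl SymModel.degree_inr
    SymModel.lie_inl_inl SymModel.lie_inr_inr
  obtain ⟨Ψ, hΨe, hΨf⟩ := h.exists_lieHom (by omega) (SymModel.degree f e) SymModel.degree_lie
    (hdeg f e) (SymModel.inr f e) (SymModel.inl f e) SymModel.degree_inr SymModel.degree_inl
    SymModel.lie_inr_inr SymModel.lie_inl_inl
  rw [injective_iff_map_eq_zero]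
  rintro ⟨w, w'⟩ hw
  rw [LinearMap.coprod_apply] at hw
  exact Prod.ext (eq_zero_of_symTripleLie_add_eq_zero hΦe hΦf hw)
    (eq_zero_of_symTripleLie_add_eq_zero hΨf hΨe ((add_comm _ _).trans hw))

end Triple

/-- For the prolongation of a free pseudo-product FGLA of type `(m, n, μ)` with
`μ ≥ 3`, `g₋₃ ≅ S²(e) ⊗ f ⊕ S²(f) ⊗ e` as a `g₀`-module (via the bracket maps),
and `dim g₋₃ = mn(m + n + 2)/2`. -/
theorem free_pp_fgla_deg_minus_three {Lm LG : Type} [LieRing Lm] [LieAlgebra ℂ Lm]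
    [LieRing LG] [LieAlgebra ℂ LG]
    (M : GLA Lm) (e f : Submodule ℂ Lm) (m n μ : ℕ) (hμ : 3 ≤ μ)
    (hfree : IsFreePPFGLA M e f m n μ)
    (G : GLA LG) (ι : Lm →ₗ⁅ℂ⁆ LG) (hprol : IsPPProlongation M e f G ι) :
    (∃ T : ((TensorProduct ℂ (symSq e) f) × (TensorProduct ℂ (symSq f) e)) ≃ₗ[ℂ]
        (G.g (-3)),
      (∀ (x : e) (y : f),
        ((T (⟨x ⊗ₜ[ℂ] x, tmul_self_mem_symSq (x : e)⟩ ⊗ₜ[ℂ] y, 0)) : LG) =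
          ⁅⁅ι (x : Lm), ι (y : Lm)⁆, ι (x : Lm)⁆) ∧
      (∀ (y : f) (x : e),
        ((T (0, ⟨y ⊗ₜ[ℂ] y, tmul_self_mem_symSq (y : f)⟩ ⊗ₜ[ℂ] x)) : LG) =
          ⁅⁅ι (y : Lm), ι (x : Lm)⁆, ι (y : Lm)⁆)) ∧
    2 * Module.finrank ℂ (G.g (-3)) = m * n * (m + n + 2) := by
  have hM := hfree.1
  have := hM.fgla.fd
  let T₀ := ι.toLinearMap ∘ₗ (symTripleLie e f).coprod (symTripleLie f e)
  have hinj : Function.Injective T₀ := hprol.inj.comp (hfree.injective_coprod_symTripleLie hμ)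
  have hrange : LinearMap.range T₀ = G.g (-3) := by
    rw [LinearMap.range_comp, hM.range_coprod_symTripleLie, hprol.graded_neg _ (by norm_num)]
  let T := (LinearEquiv.ofInjective T₀ hinj).trans (LinearEquiv.ofEq _ _ hrange)
  have hT : ∀ w, (T w : LG) = ι (symTripleLie e f w.1 + symTripleLie f e w.2) := fun _ => rfl
  refine ⟨⟨T, fun x y => ?_, fun y x => ?_⟩, ?_⟩
  · rw [hT, map_zero, add_zero, symTripleLie_tmul, tripleLie_tmul, LieHom.map_lie, LieHom.map_lie]
  · rw [hT, map_zero, zero_add, symTripleLie_tmul, tripleLie_tmul, LieHom.map_lie, LieHom.map_lie]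
  · rw [← T.finrank_eq, ← hfree.2.2.1, ← hfree.2.2.2.1]
    exact two_mul_finrank_symSq_tensorProduct_prod
end
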